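/- Fix k ≥ 2. For every type t in 𝒯_k^★, there exists a constant A_t > 0 such that, as n → ∞, [z^n] C_t(z) ∼ A_t · 4^n · n^{-3/2}. -/

import Mathlib

open FirstOrder Filter Asymptotics Topology

namespace Av231

/-- Relation symbols of the theory of two orders: two binary relations `<_P` and `<_V`. -/
inductive TwoRel : ℕ → Type
  | lp : TwoRel 2
  | lv : TwoRel 2

/-- The first-order language with two binary relation symbols `<_P` and `<_V`. -/
def L : Language := ⟨fun _ => Empty, TwoRel⟩

/-- The `L`-structure on `Fin n` associated with a permutation `σ` of `{1,…,n}`: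
`i <_P j` iff `i < j` and `i <_V j` iff `σ i < σ j`. -/
def pStruct {n : ℕ} (σ : Equiv.Perm (Fin n)) : L.Structure (Fin n) where
  funMap := fun f _ => nomatch f
  RelMap := fun r x =>
    match r with
    | .lp => x 0 < x 1
    | .lv => σ (x 0) < σ (x 1)

/-- A permutation satisfies a first-order sentence. -/
def Sat {n : ℕ} (σ : Equiv.Perm (Fin n)) (ψ : L.Sentence) : Prop :=
  @Language.Sentence.Realize L (Fin n) (pStruct σ) ψ

/-- The quantifier depth of a first-order formula. -/
def qd {L' : Language} {α : Type*} : ∀ {n : ℕ}, L'.BoundedFormula α n → ℕ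
  | _, .falsum => 0
  | _, .equal _ _ => 0
  | _, .rel _ _ => 0
  | _, .imp f g => max (qd f) (qd g)
  | _, .all f => qd f + 1

/-- A permutation avoids the pattern `231`. -/
def Avoids {n : ℕ} (σ : Equiv.Perm (Fin n)) : Prop :=
  ¬ ∃ i j k : Fin n, i < j ∧ j < k ∧ σ k < σ i ∧ σ i < σ j

/-- The number of `231`-avoiding permutations of size `n` satisfying `ψ`. -/
noncomputable def avN (n : ℕ) (ψ : L.Sentence) : ℕ :=
  Nat.card {σ : Equiv.Perm (Fin n) // Avoids σ ∧ Sat σ ψ}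

/-- The probability that a uniform random `231`-avoiding permutation of size `n`
satisfies `ψ` (the number of `231`-avoiding permutations of size `n` is `catalan n`). -/
noncomputable def prob (n : ℕ) (ψ : L.Sentence) : ℝ :=
  (avN n ψ : ℝ) / (catalan n : ℝ)

/-- Permutations of arbitrary finite size. -/
abbrev FinPerm := Σ n : ℕ, Equiv.Perm (Fin n)

def AvoidsF (p : FinPerm) : Prop := Avoids p.2

/-- Direct sum of permutations. -/
def dsum {a b : ℕ} (σ : Equiv.Perm (Fin a)) (τ : Equiv.Perm (Fin b)) :
    Equiv.Perm (Fin (a + b)) :=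
  finSumFinEquiv.permCongr (Equiv.sumCongr σ τ)

/-- Skew sum of permutations. -/
def ssum {a b : ℕ} (σ : Equiv.Perm (Fin a)) (τ : Equiv.Perm (Fin b)) :
    Equiv.Perm (Fin (a + b)) :=
  finSumFinEquiv.symm.trans ((Equiv.sumCongr σ τ).trans
    ((Equiv.sumComm (Fin a) (Fin b)).trans (finSumFinEquiv.trans (finCongr (Nat.add_comm b a)))))

/-- The operation `(τ, π) ↦ τ ⊕ (1 ⊖ π)` on permutations of arbitrary sizes. -/
def glue (τ π : FinPerm) : FinPerm :=
  ⟨τ.1 + (1 + π.1), dsum τ.2 (ssum (1 : Equiv.Perm (Fin 1)) π.2)⟩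

/-- Two permutations are `k`-equivalent when they satisfy the same first-order sentences
of quantifier depth at most `k`. -/
def kEquiv (k : ℕ) (p q : FinPerm) : Prop :=
  ∀ ψ : L.Sentence, qd ψ ≤ k → (Sat p.2 ψ ↔ Sat q.2 ψ)

end Av231

/-- `k`-equivalence as a setoid on finite permutations. -/
def kSetoid (k : ℕ) : Setoid Av231.FinPerm :=
  ⟨Av231.kEquiv k,
    ⟨fun _ _ _ => Iff.rfl, fun h ψ hψ => (h ψ hψ).symm,
      fun h h' ψ hψ => (h ψ hψ).trans (h' ψ hψ)⟩⟩

namespace Av231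

/-- Logical types of order `k`: equivalence classes of `≡ₖ`. -/
def QT (k : ℕ) := Quotient (kSetoid k)

/-- The logical type of order `k` of a permutation. -/
def typeOf (k : ℕ) (p : FinPerm) : QT k := Quotient.mk (kSetoid k) p

/-- A type is realized when some `231`-avoiding permutation has this type;
`𝒯ₖ` consists of the realized types. -/
def Realized (k : ℕ) (t : QT k) : Prop := ∃ p : FinPerm, AvoidsF p ∧ typeOf k p = t

/-- The number of `231`-avoiding permutations of size `n` whose logical type of order `k`
is `t`, i.e. the `n`-th coefficient of the generating series `C_t`. -/
noncomputable def cnt (k : ℕ) (t : QT k) (n : ℕ) : ℕ :=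
  Nat.card {σ : Equiv.Perm (Fin n) // Avoids σ ∧ typeOf k ⟨n, σ⟩ = t}

/-- The type of the empty permutation. -/
def emptyType (k : ℕ) : QT k := typeOf k ⟨0, 1⟩

/-- `H_k(t₁,t₂)`: the type of `τ ⊕ (1 ⊖ π)` where `τ, π` are representatives
of `t₁, t₂` respectively. -/
noncomputable def Hfun (k : ℕ) (t₁ t₂ : QT k) : QT k :=
  typeOf k (glue (Quotient.out t₁) (Quotient.out t₂))

/-- The edge relation `u → t` of the dependency graph `G_k`:
`∂F_t/∂C_u ≠ 0`, i.e. some `v ∈ 𝒯ₖ` satisfies `H_k(u,v) = t` or `H_k(v,u) = t`. -/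
def Edge (k : ℕ) (u t : QT k) : Prop :=
  ∃ v : QT k, Realized k v ∧ (Hfun k u v = t ∨ Hfun k v u = t)

/-- The set `𝒯ₖ` of types realized by `231`-avoiding permutations, as a type. -/
def Tk (k : ℕ) := {t : QT k // Realized k t}

/-- The edge relation of `G_k` restricted to `𝒯ₖ`. -/
def EdgeT (k : ℕ) (u t : Tk k) : Prop := Edge k u.1 t.1

/-- `S` is a terminal strongly connected component of the dependency graph `G_k`:
it is nonempty, any vertex of `S` reaches any other, and no edge leaves `S`
(this forces maximality, hence being an SCC). -/
def IsTermSCC (k : ℕ) (S : Set (Tk k)) : Prop :=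
  S.Nonempty ∧ (∀ u ∈ S, ∀ v ∈ S, Relation.ReflTransGen (EdgeT k) u v) ∧
    (∀ u ∈ S, ∀ v : Tk k, EdgeT k u v → v ∈ S)

/-- A sequence of coefficients is periodic when, for some `d ≥ 2` and `r`,
it vanishes outside `dℤ + r`. -/
def SeqPeriodic (a : ℕ → ℝ) : Prop :=
  ∃ d : ℕ, 2 ≤ d ∧ ∃ r : ℕ, ∀ n : ℕ, n % d ≠ r % d → a n = 0

/-- The generating series `C_t` of `231`-avoiding permutations of type `t`,
evaluated at a complex number `z`. -/
noncomputable def Ct (k : ℕ) (t : QT k) (z : ℂ) : ℂ :=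
  ∑' n : ℕ, (cnt k t n : ℂ) * z ^ n

/-- The Catalan generating function. -/
noncomputable def catGF (z : ℂ) : ℂ := ∑' n : ℕ, (catalan n : ℂ) * z ^ n

/-- The entry `M_k(z)_{t,u} = ∂F_t/∂C_u (z; C_v(z), v ∈ 𝒯ₖ)` of the Jacobian matrix of the
type-refined system. -/
noncomputable def Mmat (k : ℕ) (z : ℂ) (t u : QT k) : ℂ :=
  z * ((∑' v : {v : QT k // Realized k v ∧ Hfun k u v = t}, Ct k v.1 z) +
       (∑' v : {v : QT k // Realized k v ∧ Hfun k v u = t}, Ct k v.1 z))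

/-- `lam` is an eigenvalue of the (possibly infinite) matrix `A`, witnessed by a finitely
supported eigenvector. For finite index types this is the usual notion of eigenvalue. -/
def IsEig {α : Type*} (A : α → α → ℂ) (lam : ℂ) : Prop :=
  ∃ v : α →₀ ℂ, v ≠ 0 ∧ ∀ x : α, ∑ y ∈ v.support, A x y * v y = lam * v x

/-! ### Back-and-forth systems -/

/-- Realization of a formula in the structure of a permutation. -/
def Holds (p : FinPerm) {n : ℕ} (φ : L.BoundedFormula Empty n) (a : Fin n → Fin p.1) : Prop :=
  @Language.BoundedFormula.Realize L (Fin p.1) (pStruct p.2) Empty n φ default a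

/-- Two tuples satisfy the same formulas of quantifier depth at most `k`. -/
def TupleEquiv (k : ℕ) {p q : FinPerm} {n : ℕ} (a : Fin n → Fin p.1) (b : Fin n → Fin q.1) :
    Prop :=
  ∀ φ : L.BoundedFormula Empty n, qd φ ≤ k → (Holds p φ a ↔ Holds q φ b)

/-- The truth values of the atomic formulas on two elements of a permutation. -/
def atoms (p : FinPerm) (x y : Fin p.1) : Prop × Prop × Prop :=
  (x = y, x < y, p.2 x < p.2 y)

/-- Two tuples satisfy the same atomic formulas. -/
def AtomEquiv {p q : FinPerm} {n : ℕ} (a : Fin n → Fin p.1) (b : Fin n → Fin q.1) : Prop :=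
  ∀ i j, atoms p (a i) (a j) = atoms q (b i) (b j)

theorem term_eq_var {n : ℕ} (t : L.Term (Empty ⊕ Fin n)) :
    ∃ i : Fin n, t = Language.Term.var (Sum.inr i) := by
  cases t with
  | var x =>
    cases x with
    | inl x => exact x.elim
    | inr i => exact ⟨i, rfl⟩
  | func f _ => exact Empty.elim f

/-- Ehrenfeucht–Fraïssé: a back-and-forth system preserves formulas. -/
theorem tupleEquiv_of_system {p q : FinPerm}
    (R : ℕ → ∀ n, (Fin n → Fin p.1) → (Fin n → Fin q.1) → Prop)
    (hatom : ∀ k n a b, R k n a b → AtomEquiv a b)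
    (hforth : ∀ k n a b, R (k + 1) n a b → ∀ c, ∃ d, R k (n + 1) (Fin.snoc a c) (Fin.snoc b d))
    (hback : ∀ k n a b, R (k + 1) n a b → ∀ d, ∃ c, R k (n + 1) (Fin.snoc a c) (Fin.snoc b d))
    {k n : ℕ} {a : Fin n → Fin p.1} {b : Fin n → Fin q.1} (h : R k n a b) :
    TupleEquiv k a b := by
  intro φ
  induction φ generalizing k with
  | falsum => exact fun _ => Iff.rfl
  | equal s t =>
    intro _
    obtain ⟨i, rfl⟩ := term_eq_var s
    obtain ⟨j, rfl⟩ := term_eq_var t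
    exact iff_of_eq (congrArg Prod.fst (hatom _ _ _ _ h i j))
  | rel r ts =>
    intro _
    let _ := pStruct p.2
    let _ := pStruct q.2
    cases r with
    | lp =>
      obtain ⟨i, hi⟩ := term_eq_var (ts 0)
      obtain ⟨j, hj⟩ := term_eq_var (ts 1)
      have := congrArg (fun x => x.2.1) (hatom _ _ _ _ h i j)
      change ((ts 0).realize _ < (ts 1).realize _) ↔ ((ts 0).realize _ < (ts 1).realize _)
      rw [hi, hj]
      exact iff_of_eq this
    | lv =>
      obtain ⟨i, hi⟩ := term_eq_var (ts 0)
      obtain ⟨j, hj⟩ := term_eq_var (ts 1)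
      have := congrArg (fun x => x.2.2) (hatom _ _ _ _ h i j)
      change (p.2 ((ts 0).realize _) < p.2 ((ts 1).realize _)) ↔
        (q.2 ((ts 0).realize _) < q.2 ((ts 1).realize _))
      rw [hi, hj]
      exact iff_of_eq this
  | imp f g ihf ihg =>
    intro hk
    have hk' : max (qd f) (qd g) ≤ k := hk
    exact imp_congr (ihf h (le_trans (le_max_left _ _) hk'))
      (ihg h (le_trans (le_max_right _ _) hk'))
  | all f ih =>
    intro hk
    have hk' : qd f + 1 ≤ k := hk
    obtain ⟨k, rfl⟩ : ∃ m, k = m + 1 := ⟨k - 1, by omega⟩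
    constructor
    · intro H d
      obtain ⟨c, hc⟩ := hback _ _ _ _ h d
      exact (ih hc (by omega)).1 (H c)
    · intro H c
      obtain ⟨d, hd⟩ := hforth _ _ _ _ h c
      exact (ih hd (by omega)).2 (H d)

theorem TupleEquiv.symm {k : ℕ} {p q : FinPerm} {n : ℕ} {a : Fin n → Fin p.1}
    {b : Fin n → Fin q.1} (h : TupleEquiv k a b) : TupleEquiv k b a :=
  fun φ hφ => (h φ hφ).symm

theorem TupleEquiv.atomEquiv {k : ℕ} {p q : FinPerm} {n : ℕ} {a : Fin n → Fin p.1}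
    {b : Fin n → Fin q.1} (h : TupleEquiv k a b) : AtomEquiv a b := by
  intro i j
  have h1 := h (.equal (.var (.inr i)) (.var (.inr j))) (Nat.zero_le _)
  have h2 := h (.rel (TwoRel.lp : L.Relations 2) ![.var (.inr i), .var (.inr j)])
    (Nat.zero_le _)
  have h3 := h (.rel (TwoRel.lv : L.Relations 2) ![.var (.inr i), .var (.inr j)])
    (Nat.zero_le _)
  exact Prod.ext (propext h1) (Prod.ext (propext h2) (propext h3))

theorem qd_foldr_inf {n k : ℕ} (l : List (L.BoundedFormula Empty n)) (h : ∀ φ ∈ l, qd φ ≤ k) :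
    qd (l.foldr (· ⊓ ·) ⊤) ≤ k := by
  induction l with
  | nil => exact Nat.zero_le _
  | cons φ l ih =>
    have h1 := h φ (by simp)
    have h2 := ih fun ψ hψ => h ψ (by simp [hψ])
    change max (max (qd φ) (max (qd (l.foldr (· ⊓ ·) ⊤)) 0)) 0 ≤ k
    simp [h1, h2]

theorem TupleEquiv.forth {k : ℕ} {p q : FinPerm} {n : ℕ} {a : Fin n → Fin p.1}
    {b : Fin n → Fin q.1} (h : TupleEquiv (k + 1) a b) (c : Fin p.1) :
    ∃ d : Fin q.1, TupleEquiv k (p := p) (q := q) (n := n + 1) (Fin.snoc a c) (Fin.snoc b d) := by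
  by_contra hno
  have key : ∀ d : Fin q.1, ∃ φ : L.BoundedFormula Empty (n + 1), qd φ ≤ k ∧
      Holds p φ (Fin.snoc a c) ∧ ¬ Holds q φ (Fin.snoc b d) := by
    intro d
    by_contra hd
    refine hno ⟨d, fun φ hφ => ⟨fun h1 => ?_, fun h1 => ?_⟩⟩
    · by_contra h2
      exact hd ⟨φ, hφ, h1, h2⟩
    · by_contra h2
      refine hd ⟨φ.not, ?_, h2, fun h3 => h3 h1⟩
      change max (qd φ) 0 ≤ k
      simpa using hφ
  choose φ hφ h1 h2 using key
  let _ := pStruct p.2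
  let _ := pStruct q.2
  let θ : L.BoundedFormula Empty (n + 1) := (List.ofFn φ).foldr (· ⊓ ·) ⊤
  have hθ : qd θ.ex ≤ k + 1 := by
    have : qd θ ≤ k := qd_foldr_inf _ fun ψ hψ => by
      obtain ⟨d, rfl⟩ := (List.mem_ofFn' _ _).1 hψ
      exact hφ d
    change max (max (qd θ) 0 + 1) 0 ≤ k + 1
    simpa using this
  have hp : Holds p θ.ex a := by
    refine Language.BoundedFormula.realize_ex.2 ⟨c, ?_⟩
    refine (Language.BoundedFormula.realize_foldr_inf _ _ _).2 fun ψ hψ => ?_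
    obtain ⟨d, rfl⟩ := (List.mem_ofFn' _ _).1 hψ
    exact h1 d
  obtain ⟨d, hd⟩ := Language.BoundedFormula.realize_ex.1 ((h _ hθ).1 hp)
  exact h2 d ((Language.BoundedFormula.realize_foldr_inf _ _ _).1 hd _
    ((List.mem_ofFn' _ _).2 ⟨d, rfl⟩))

theorem TupleEquiv.back {k : ℕ} {p q : FinPerm} {n : ℕ} {a : Fin n → Fin p.1}
    {b : Fin n → Fin q.1} (h : TupleEquiv (k + 1) a b) (d : Fin q.1) :
    ∃ c : Fin p.1, TupleEquiv k (p := p) (q := q) (n := n + 1) (Fin.snoc a c) (Fin.snoc b d) :=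
  let ⟨c, hc⟩ := h.symm.forth d
  ⟨c, hc.symm⟩

theorem kEquiv_iff_tupleEquiv {k : ℕ} {p q : FinPerm} :
    kEquiv k p q ↔ TupleEquiv k (default : Fin 0 → Fin p.1) (default : Fin 0 → Fin q.1) :=
  Iff.rfl

/-! ### Finiteness of the set of types -/

/-- Codes for rank-`k` types of `n`-tuples. -/
def Code : ℕ → ℕ → Type
  | 0, n => Fin n → Fin n → Prop × Prop × Prop
  | k + 1, n => (Fin n → Fin n → Prop × Prop × Prop) × Set (Code k (n + 1))

theorem finite_code (k n : ℕ) : Finite (Code k n) := by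
  induction k generalizing n with
  | zero => exact inferInstanceAs (Finite (Fin n → Fin n → Prop × Prop × Prop))
  | succ k ih =>
    have := ih (n + 1)
    exact inferInstanceAs
      (Finite ((Fin n → Fin n → Prop × Prop × Prop) × Set (Code k (n + 1))))

/-- The code of the rank-`k` type of a tuple. -/
def code (p : FinPerm) : ∀ (k n : ℕ), (Fin n → Fin p.1) → Code k n
  | 0, _, a => fun i j => atoms p (a i) (a j)
  | k + 1, n, a => (fun i j => atoms p (a i) (a j), {x | ∃ c, code p k (n + 1) (Fin.snoc a c) = x})

theorem tupleEquiv_of_code_eq {p q : FinPerm} {k n : ℕ} {a : Fin n → Fin p.1}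
    {b : Fin n → Fin q.1} (h : code p k n a = code q k n b) : TupleEquiv k a b := by
  refine tupleEquiv_of_system (fun k n a b => code p k n a = code q k n b) ?_ ?_ ?_ h
  · intro k n a b h i j
    cases k with
    | zero => exact congrFun (congrFun h i) j
    | succ k => exact congrFun (congrFun (congrArg Prod.fst h) i) j
  · intro k n a b h c
    have h2 : {x | ∃ c, code p k (n + 1) (Fin.snoc a c) = x} =
      {x | ∃ c, code q k (n + 1) (Fin.snoc b c) = x} := congrArg Prod.snd h
    obtain ⟨d, hd⟩ := h2.subset ⟨c, rfl⟩
    exact ⟨d, hd.symm⟩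
  · intro k n a b h d
    have h2 : {x | ∃ c, code p k (n + 1) (Fin.snoc a c) = x} =
      {x | ∃ c, code q k (n + 1) (Fin.snoc b c) = x} := congrArg Prod.snd h
    exact h2.superset ⟨d, rfl⟩

theorem finite_QT (k : ℕ) : Finite (QT k) := by
  have := finite_code k 0
  refine Finite.of_injective (fun t : QT k => code (Quotient.out t) k 0 default) fun s t h => ?_
  exact Quotient.out_equiv_out.1 (show kEquiv k _ _ from
    kEquiv_iff_tupleEquiv.2 (tupleEquiv_of_code_eq h))

/-! ### The operation `τ ⊕ (1 ⊖ π)` -/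

/-- The values of a permutation as a function on natural numbers (zero outside its domain). -/
def val (p : FinPerm) (i : ℕ) : ℕ := if h : i < p.1 then p.2 ⟨i, h⟩ else 0

theorem val_of_lt {p : FinPerm} {i : ℕ} (h : i < p.1) : val p i = p.2 ⟨i, h⟩ := dif_pos h

theorem coe_apply_eq_val (p : FinPerm) (i : Fin p.1) : (p.2 i : ℕ) = val p i :=
  (val_of_lt i.2).symm

theorem val_lt {p : FinPerm} {i : ℕ} (h : i < p.1) : val p i < p.1 := by
  rw [val_of_lt h]; exact (p.2 _).2

theorem val_inj {p : FinPerm} {i j : ℕ} (hi : i < p.1) (hj : j < p.1) (h : val p i = val p j) :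
    i = j := by
  rw [val_of_lt hi, val_of_lt hj] at h
  simpa using p.2.injective (Fin.ext h)

theorem finPerm_ext {p q : FinPerm} (h : p.1 = q.1) (hv : ∀ i < p.1, val p i = val q i) :
    p = q := by
  obtain ⟨n, σ⟩ := p
  obtain ⟨m, τ⟩ := q
  obtain rfl : n = m := h
  congr 1
  ext i
  simpa [coe_apply_eq_val ⟨n, σ⟩, coe_apply_eq_val ⟨n, τ⟩] using hv i i.2

theorem glue_fst (p q : FinPerm) : (glue p q).1 = p.1 + (1 + q.1) := rfl

theorem val_glue_left (p q : FinPerm) {i : ℕ} (h : i < p.1) : val (glue p q) i = val p i := by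
  have hi : i < (glue p q).1 := by rw [glue_fst]; omega
  rw [val_of_lt hi, val_of_lt h]
  have : (⟨i, hi⟩ : Fin (p.1 + (1 + q.1))) = finSumFinEquiv (Sum.inl ⟨i, h⟩) := by
    ext; simp
  change (dsum p.2 (ssum (1 : Equiv.Perm (Fin 1)) q.2) ⟨i, hi⟩ : ℕ) = _
  rw [this]
  simp [dsum, -finSumFinEquiv_apply_left, Equiv.permCongr_apply]
  simp

theorem val_glue_mid (p q : FinPerm) : val (glue p q) p.1 = p.1 + q.1 := by
  have hi : p.1 < (glue p q).1 := by rw [glue_fst]; omega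
  rw [val_of_lt hi]
  have : (⟨p.1, hi⟩ : Fin (p.1 + (1 + q.1))) =
      finSumFinEquiv (Sum.inr (finSumFinEquiv (Sum.inl 0))) := by
    ext; simp
  change (dsum p.2 (ssum (1 : Equiv.Perm (Fin 1)) q.2) ⟨p.1, hi⟩ : ℕ) = _
  rw [this]
  simp [dsum, ssum, -finSumFinEquiv_apply_left, Equiv.permCongr_apply]

theorem val_glue_right (p q : FinPerm) {i : ℕ} (h : i < q.1) :
    val (glue p q) (p.1 + (1 + i)) = p.1 + val q i := by
  have hi : p.1 + (1 + i) < (glue p q).1 := by rw [glue_fst]; omega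
  rw [val_of_lt hi, val_of_lt h]
  have : (⟨p.1 + (1 + i), hi⟩ : Fin (p.1 + (1 + q.1))) =
      finSumFinEquiv (Sum.inr (finSumFinEquiv (Sum.inr ⟨i, h⟩))) := by
    ext; simp
  change (dsum p.2 (ssum (1 : Equiv.Perm (Fin 1)) q.2) ⟨p.1 + (1 + i), hi⟩ : ℕ) = _
  rw [this]
  simp [dsum, ssum, -finSumFinEquiv_apply_right, Equiv.permCongr_apply]
  simp

/-- Every position of `glue p q` lies on the left, is the position of the maximum, or lies on
the right. -/
theorem glue_cases {p q : FinPerm} {i : ℕ} (h : i < (glue p q).1) :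
    i < p.1 ∨ i = p.1 ∨ ∃ j < q.1, i = p.1 + (1 + j) := by
  rw [glue_fst] at h
  rcases lt_trichotomy i p.1 with h1 | h1 | h1
  · exact Or.inl h1
  · exact Or.inr (Or.inl h1)
  · exact Or.inr (Or.inr ⟨i - p.1 - 1, by omega, by omega⟩)

theorem atoms_eq_iff {p q : FinPerm} {x y : Fin p.1} {x' y' : Fin q.1} :
    atoms p x y = atoms q x' y' ↔ ((x : ℕ) = y ↔ (x' : ℕ) = y') ∧ ((x : ℕ) < y ↔ (x' : ℕ) < y') ∧
      (val p x < val p y ↔ val q x' < val q y') := by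
  simp only [atoms, Prod.ext_iff, eq_iff_iff, Fin.ext_iff, Fin.lt_def, coe_apply_eq_val]

/-- Corresponding positions in `glue p q` and `glue p' q'`, relative to tuples in the factors. -/
def GlueMatch (p q p' q' : FinPerm) {m₁ m₂ : ℕ} (u : Fin m₁ → Fin p.1) (u' : Fin m₁ → Fin p'.1)
    (v : Fin m₂ → Fin q.1) (v' : Fin m₂ → Fin q'.1) (x y : ℕ) : Prop :=
  (∃ j, x = u j ∧ y = u' j) ∨ (x = p.1 ∧ y = p'.1) ∨
    ∃ j, x = p.1 + (1 + v j) ∧ y = p'.1 + (1 + v' j)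

theorem GlueMatch.snoc_left {p q p' q' : FinPerm} {m₁ m₂ : ℕ} {u : Fin m₁ → Fin p.1}
    {u' : Fin m₁ → Fin p'.1} {v : Fin m₂ → Fin q.1} {v' : Fin m₂ → Fin q'.1} {x y : ℕ}
    (h : GlueMatch p q p' q' u u' v v' x y) (c : Fin p.1) (d : Fin p'.1) :
    GlueMatch p q p' q' (m₁ := m₁ + 1) (Fin.snoc u c) (Fin.snoc u' d) v v' x y := by
  rcases h with ⟨j, h⟩ | h | ⟨j, h⟩
  · exact Or.inl ⟨j.castSucc, by simpa using h⟩
  · exact Or.inr (Or.inl h)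
  · exact Or.inr (Or.inr ⟨j, h⟩)

theorem GlueMatch.snoc_right {p q p' q' : FinPerm} {m₁ m₂ : ℕ} {u : Fin m₁ → Fin p.1}
    {u' : Fin m₁ → Fin p'.1} {v : Fin m₂ → Fin q.1} {v' : Fin m₂ → Fin q'.1} {x y : ℕ}
    (h : GlueMatch p q p' q' u u' v v' x y) (c : Fin q.1) (d : Fin q'.1) :
    GlueMatch p q p' q' (m₂ := m₂ + 1) u u' (Fin.snoc v c) (Fin.snoc v' d) x y := by
  rcases h with h | h | ⟨j, h⟩
  · exact Or.inl h
  · exact Or.inr (Or.inl h)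
  · exact Or.inr (Or.inr ⟨j.castSucc, by simpa using h⟩)

theorem GlueMatch.atoms {p q p' q' : FinPerm} {m₁ m₂ : ℕ} {u : Fin m₁ → Fin p.1}
    {u' : Fin m₁ → Fin p'.1} {v : Fin m₂ → Fin q.1} {v' : Fin m₂ → Fin q'.1}
    (hu : AtomEquiv u u') (hv : AtomEquiv v v') {x₁ x₂ y₁ y₂ : ℕ}
    (h₁ : GlueMatch p q p' q' u u' v v' x₁ y₁) (h₂ : GlueMatch p q p' q' u u' v v' x₂ y₂) :
    (x₁ = x₂ ↔ y₁ = y₂) ∧ (x₁ < x₂ ↔ y₁ < y₂) ∧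
      (val (glue p q) x₁ < val (glue p q) x₂ ↔ val (glue p' q') y₁ < val (glue p' q') y₂) := by
  have lp := fun j => val_lt (u j).2
  have lp' := fun j => val_lt (u' j).2
  have lq := fun j => val_lt (v j).2
  have lq' := fun j => val_lt (v' j).2
  rcases h₁ with ⟨i, rfl, rfl⟩ | ⟨rfl, rfl⟩ | ⟨i, rfl, rfl⟩ <;>
    rcases h₂ with ⟨j, rfl, rfl⟩ | ⟨rfl, rfl⟩ | ⟨j, rfl, rfl⟩ <;>
    simp only [val_glue_left, val_glue_mid, val_glue_right, Fin.is_lt]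
  · exact atoms_eq_iff.1 (hu i j)
  · have := lp i; have := lp' i; have := (u i).2; have := (u' i).2
    exact ⟨by omega, trivial, by omega⟩
  · have := lp i; have := lp' i; have := (u i).2; have := (u' i).2; omega
  · have := lp j; have := lp' j; have := (u j).2; have := (u' j).2; omega
  · simp
  · have := lq j; have := lq' j; omega
  · have := lp j; have := lp' j; have := (u j).2; have := (u' j).2; omega
  · have := lq i; have := lq' i; omega
  · have := atoms_eq_iff.1 (hv i j)
    refine ⟨?_, ?_, ?_⟩ <;> omega

/-- `≡ₖ` is a congruence for `glue`. -/
theorem kEquiv_glue {k : ℕ} {p q p' q' : FinPerm} (hp : kEquiv k p p') (hq : kEquiv k q q') :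
    kEquiv k (glue p q) (glue p' q') := by
  rw [kEquiv_iff_tupleEquiv] at *
  refine tupleEquiv_of_system (fun k n a b => ∃ (m₁ m₂ : ℕ) (u : Fin m₁ → Fin p.1)
    (u' : Fin m₁ → Fin p'.1) (v : Fin m₂ → Fin q.1) (v' : Fin m₂ → Fin q'.1),
    TupleEquiv k u u' ∧ TupleEquiv k v v' ∧
      ∀ i, GlueMatch p q p' q' u u' v v' (a i) (b i)) ?_ ?_ ?_
    ⟨0, 0, _, _, _, _, hp, hq, fun i => i.elim0⟩
  · rintro k n a b ⟨m₁, m₂, u, u', v, v', hu, hv, h⟩ i j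
    exact atoms_eq_iff.2 ((h i).atoms hu.atomEquiv hv.atomEquiv (h j))
  · rintro k n a b ⟨m₁, m₂, u, u', v, v', hu, hv, h⟩ c
    have hk : ∀ {p q : FinPerm} {n} {a : Fin n → Fin p.1} {b : Fin n → Fin q.1},
      TupleEquiv (k + 1) a b → TupleEquiv k a b := fun h φ hφ => h φ (by omega)
    obtain ⟨c, hc⟩ := c
    rcases glue_cases hc with h1 | rfl | ⟨j, hj, rfl⟩
    · obtain ⟨d, hd⟩ := hu.forth ⟨c, h1⟩
      refine ⟨⟨d, by have := d.2; rw [glue_fst]; omega⟩, m₁ + 1, m₂, _, _, v, v', hd, hk hv, ?_⟩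
      refine Fin.lastCases (Or.inl ⟨Fin.last _, by simp⟩) fun i => ?_
      simpa using (h i).snoc_left _ _
    · refine ⟨⟨p'.1, by rw [glue_fst]; omega⟩, m₁, m₂, u, u', v, v', hk hu, hk hv, ?_⟩
      refine Fin.lastCases (Or.inr (Or.inl (by simp))) fun i => ?_
      simpa using h i
    · obtain ⟨d, hd⟩ := hv.forth ⟨j, hj⟩
      refine ⟨⟨p'.1 + (1 + d), by have := d.2; rw [glue_fst]; omega⟩, m₁, m₂ + 1, u, u', _, _,
        hk hu, hd, ?_⟩
      refine Fin.lastCases (Or.inr (Or.inr ⟨Fin.last _, by simp⟩)) fun i => ?_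
      simpa using (h i).snoc_right _ _
  · rintro k n a b ⟨m₁, m₂, u, u', v, v', hu, hv, h⟩ d
    have hk : ∀ {p q : FinPerm} {n} {a : Fin n → Fin p.1} {b : Fin n → Fin q.1},
      TupleEquiv (k + 1) a b → TupleEquiv k a b := fun h φ hφ => h φ (by omega)
    obtain ⟨d, hd⟩ := d
    rcases glue_cases hd with h1 | rfl | ⟨j, hj, rfl⟩
    · obtain ⟨c, hc⟩ := hu.back ⟨d, h1⟩
      refine ⟨⟨c, by have := c.2; rw [glue_fst]; omega⟩, m₁ + 1, m₂, _, _, v, v', hc, hk hv, ?_⟩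
      refine Fin.lastCases (Or.inl ⟨Fin.last _, by simp⟩) fun i => ?_
      simpa using (h i).snoc_left _ _
    · refine ⟨⟨p.1, by rw [glue_fst]; omega⟩, m₁, m₂, u, u', v, v', hk hu, hk hv, ?_⟩
      refine Fin.lastCases (Or.inr (Or.inl (by simp))) fun i => ?_
      simpa using h i
    · obtain ⟨c, hc⟩ := hv.back ⟨j, hj⟩
      refine ⟨⟨p.1 + (1 + c), by have := c.2; rw [glue_fst]; omega⟩, m₁, m₂ + 1, u, u', _, _,
        hk hu, hc, ?_⟩
      refine Fin.lastCases (Or.inr (Or.inr ⟨Fin.last _, by simp⟩)) fun i => ?_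
      simpa using (h i).snoc_right _ _

theorem typeOf_glue (k : ℕ) (p q : FinPerm) :
    typeOf k (glue p q) = Hfun k (typeOf k p) (typeOf k q) := by
  refine Quotient.sound (s := kSetoid k) (kEquiv_glue ?_ ?_)
  · exact (kSetoid k).iseqv.symm (Quotient.mk_out (s := kSetoid k) p)
  · exact (kSetoid k).iseqv.symm (Quotient.mk_out (s := kSetoid k) q)

/-! ### Aperiodicity -/

/-- The empty permutation. -/
def nilPerm : FinPerm := ⟨0, 1⟩

/-- The permutation `p ⊕ 1 ⊕ ⋯ ⊕ 1` with `N` summands `1`. -/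
def pad (N : ℕ) (p : FinPerm) : FinPerm := (fun q => glue q nilPerm)^[N] p

theorem pad_succ (N : ℕ) (p : FinPerm) : pad (N + 1) p = glue (pad N p) nilPerm :=
  Function.iterate_succ_apply' _ _ _

theorem pad_fst (N : ℕ) (p : FinPerm) : (pad N p).1 = p.1 + N := by
  induction N with
  | zero => rfl
  | succ N ih => rw [pad_succ, glue_fst, ih]; rfl

theorem val_pad_left (N : ℕ) (p : FinPerm) {i : ℕ} (h : i < p.1) : val (pad N p) i = val p i := by
  induction N with
  | zero => rfl
  | succ N ih => rw [pad_succ, val_glue_left _ _ (by rw [pad_fst]; omega), ih]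

theorem val_pad_right (N : ℕ) (p : FinPerm) {i : ℕ} (h : p.1 ≤ i) (hi : i < p.1 + N) :
    val (pad N p) i = i := by
  induction N with
  | zero => omega
  | succ N ih =>
    rw [pad_succ]
    rcases lt_or_eq_of_le (show i ≤ p.1 + N by omega) with h1 | h1
    · rw [val_glue_left _ _ (by rw [pad_fst]; omega), ih h1]
    · have := val_glue_mid (pad N p) nilPerm
      rw [pad_fst] at this
      rw [h1, this]
      rfl

/-- Shifting the numbers that are at least `g`. -/
def shift (g x : ℕ) : ℕ := if x < g then x else x + 1

theorem shift_lt_iff (g x y : ℕ) : shift g x < shift g y ↔ x < y := by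
  unfold shift; split_ifs <;> omega

theorem shift_inj_iff (g x y : ℕ) : shift g x = shift g y ↔ x = y := by
  unfold shift; split_ifs <;> omega

theorem val_pad_shift {N g : ℕ} {p : FinPerm} (hg : p.1 ≤ g) {x : ℕ} (hx : x < p.1 + N) :
    val (pad (N + 1) p) (shift g x) = shift g (val (pad N p) x) := by
  by_cases h : x < p.1
  · have h1 : shift g x = x := if_pos (by omega)
    rw [h1, val_pad_left _ _ h, val_pad_left _ _ h]
    exact (if_pos (by have := val_lt h; omega)).symm
  · rw [val_pad_right N p (by omega) hx]
    refine val_pad_right _ _ ?_ ?_ <;> unfold shift <;> split_ifs <;> omega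

/-- In the game on `p ⊕ 1 ⊕ ⋯ ⊕ 1` with `N` and `N + 1` final points, the second player keeps
a cut `g` at distance `2 ^ k - 1` from all played points. -/
theorem kEquiv_pad (k N : ℕ) (hN : 2 * 2 ^ k ≤ N) (p : FinPerm) :
    kEquiv k (pad N p) (pad (N + 1) p) := by
  rw [kEquiv_iff_tupleEquiv]
  refine tupleEquiv_of_system (fun k n a b => ∃ g D, D + 1 = 2 ^ k ∧ p.1 + D ≤ g ∧ g + D ≤ p.1 + N ∧
    ∀ i, ((a i : ℕ) + D < g ∨ g + D ≤ (a i : ℕ)) ∧ (b i : ℕ) = shift g (a i)) ?_ ?_ ?_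
    ⟨p.1 + 2 ^ k, 2 ^ k - 1, ?_, ?_, ?_, fun i => i.elim0⟩
  · rintro k n a b ⟨g, D, hD, hg, hg', h⟩ i j
    rw [atoms_eq_iff, (h i).2, (h j).2, shift_lt_iff, shift_inj_iff,
      val_pad_shift (by omega) ((a i).2.trans_eq (pad_fst N p)),
      val_pad_shift (by omega) ((a j).2.trans_eq (pad_fst N p)), shift_lt_iff]
    exact ⟨Iff.rfl, Iff.rfl, Iff.rfl⟩
  · rintro k n a b ⟨g, D, hD, hg, hg', h⟩ c
    have hc : (c : ℕ) < p.1 + N := c.2.trans_eq (pad_fst N p)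
    obtain ⟨E, hE⟩ : ∃ E, E + 1 = 2 ^ k := ⟨2 ^ k - 1, Nat.sub_add_cancel Nat.one_le_two_pow⟩
    have hDE : D = 2 * E + 1 := by rw [pow_succ] at hD; omega
    obtain ⟨g', h1, h2, h3, h4⟩ : ∃ g', p.1 + E ≤ g' ∧ g' + E ≤ p.1 + N ∧
        ((c : ℕ) + E < g' ∨ g' + E ≤ (c : ℕ)) ∧ g' ≤ g + E + 1 ∧ g ≤ g' + E := by
      by_cases h1 : (c : ℕ) + E < g ∨ g + E ≤ c
      · exact ⟨g, by omega, by omega, h1, by omega, by omega⟩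
      · by_cases h2 : (c : ℕ) < g
        · exact ⟨g + E + 1, by omega, by omega, by omega, by omega, by omega⟩
        · exact ⟨g - E, by omega, by omega, by omega, by omega, by omega⟩
    refine ⟨⟨shift g' c, ?_⟩, g', E, hE, h1, h2, Fin.lastCases ?_ fun i => ?_⟩
    · rw [pad_fst (N + 1)]; unfold shift; split_ifs <;> omega
    · simpa using h3
    · have := h i
      simp only [Fin.snoc_castSucc]
      refine ⟨by omega, this.2.trans ?_⟩
      unfold shift; split_ifs <;> omega
  · rintro k n a b ⟨g, D, hD, hg, hg', h⟩ d
    have hd : (d : ℕ) < p.1 + (N + 1) := d.2.trans_eq (pad_fst (N + 1) p)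
    obtain ⟨E, hE⟩ : ∃ E, E + 1 = 2 ^ k := ⟨2 ^ k - 1, Nat.sub_add_cancel Nat.one_le_two_pow⟩
    have hDE : D = 2 * E + 1 := by rw [pow_succ] at hD; omega
    obtain ⟨c, g', h0, h1, h2, h3, h4, h5⟩ : ∃ c g', c < p.1 + N ∧ p.1 + E ≤ g' ∧
        g' + E ≤ p.1 + N ∧ (c + E < g' ∨ g' + E ≤ c) ∧ (g' ≤ g + E + 1 ∧ g ≤ g' + E) ∧
        (d : ℕ) = shift g' c := by
      by_cases h1 : (d : ℕ) + E < g
      · refine ⟨d, g, by omega, by omega, by omega, by omega, by omega, ?_⟩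
        exact (if_pos (by omega)).symm
      · by_cases h2 : (d : ℕ) ≤ g
        · refine ⟨d, g + E + 1, by omega, by omega, by omega, by omega, by omega, ?_⟩
          exact (if_pos (by omega)).symm
        · by_cases h3 : (d : ℕ) ≤ g + E
          · refine ⟨d - 1, g - E, by omega, by omega, by omega, by omega, by omega, ?_⟩
            unfold shift; split_ifs <;> omega
          · refine ⟨d - 1, g, by omega, by omega, by omega, by omega, by omega, ?_⟩
            unfold shift; split_ifs <;> omega
    refine ⟨⟨c, by rw [pad_fst]; omega⟩, g', E, hE, h1, h2, Fin.lastCases ?_ fun i => ?_⟩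
    · simpa using ⟨h3, h5⟩
    · have := h i
      simp only [Fin.snoc_castSucc]
      refine ⟨by omega, this.2.trans ?_⟩
      unfold shift; split_ifs <;> omega
  · exact Nat.sub_add_cancel Nat.one_le_two_pow
  · omega
  · omega

/-! ### Permutations avoiding `231` and binary trees -/

/-- The `231`-avoiding permutation encoded by a binary tree. -/
def toPerm : BinaryTree Unit → FinPerm
  | .nil => nilPerm
  | .node _ l r => glue (toPerm l) (toPerm r)

theorem toPerm_fst (x : BinaryTree Unit) : (toPerm x).1 = x.numNodes := by
  induction x with
  | nil => rfl
  | node a l r hl hr =>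
    change (toPerm l).1 + (1 + (toPerm r).1) = l.numNodes + r.numNodes + 1
    omega

theorem avoidsF_iff (p : FinPerm) : AvoidsF p ↔
    ∀ i j k : ℕ, i < j → j < k → k < p.1 → val p k < val p i → ¬ val p i < val p j := by
  constructor
  · intro h i j k hij hjk hk h1 h2
    refine h ⟨⟨i, by omega⟩, ⟨j, by omega⟩, ⟨k, hk⟩, hij, hjk, ?_, ?_⟩
    · rw [Fin.lt_def]; simpa only [coe_apply_eq_val] using h1
    · rw [Fin.lt_def]; simpa only [coe_apply_eq_val] using h2
  · rintro h ⟨i, j, k, hij, hjk, h1, h2⟩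
    rw [Fin.lt_def, coe_apply_eq_val, coe_apply_eq_val] at h1 h2
    exact h i j k hij hjk k.2 h1 h2

theorem avoidsF_glue {p q : FinPerm} : AvoidsF (glue p q) ↔ AvoidsF p ∧ AvoidsF q := by
  simp only [avoidsF_iff]
  constructor
  · refine fun h => ⟨fun i j k hij hjk hk h1 h2 => ?_, fun i j k hij hjk hk h1 h2 => ?_⟩
    · refine h i j k hij hjk (by rw [glue_fst]; omega) ?_ ?_ <;>
      · rw [val_glue_left _ _ (by omega), val_glue_left _ _ (by omega)]; assumption
    · refine h (p.1 + (1 + i)) (p.1 + (1 + j)) (p.1 + (1 + k)) (by omega) (by omega)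
        (by rw [glue_fst]; omega) ?_ ?_ <;>
      · rw [val_glue_right _ _ (by omega), val_glue_right _ _ (by omega)]; omega
  · rintro ⟨hp, hq⟩ i j k hij hjk hk h1 h2
    rcases glue_cases hk with hk' | rfl | ⟨k, hk', rfl⟩
    · rw [val_glue_left _ _ hk', val_glue_left _ _ (by omega)] at h1
      rw [val_glue_left _ _ (by omega), val_glue_left _ _ (by omega)] at h2
      exact hp i j k hij hjk hk' h1 h2
    · rw [val_glue_mid, val_glue_left _ _ (by omega)] at h1
      have := val_lt (show i < p.1 by omega)
      omega
    · have hkq := val_lt hk'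
      rw [val_glue_right _ _ hk'] at h1
      rcases glue_cases (show i < (glue p q).1 by omega) with hi | rfl | ⟨i, hi, rfl⟩
      · rw [val_glue_left _ _ hi] at h1
        have := val_lt hi
        omega
      · obtain ⟨j, hj, rfl⟩ : ∃ j' < q.1, j = p.1 + (1 + j') :=
          ⟨j - p.1 - 1, by omega, by omega⟩
        rw [val_glue_mid, val_glue_right _ _ hj] at h2
        have := val_lt hj
        omega
      · obtain ⟨j, hj, rfl⟩ : ∃ j' < q.1, j = p.1 + (1 + j') :=
          ⟨j - p.1 - 1, by omega, by omega⟩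
        rw [val_glue_right _ _ hi] at h1
        rw [val_glue_right _ _ hi, val_glue_right _ _ hj] at h2
        exact hq i j k (by omega) (by omega) hk' (by omega) (by omega)

theorem glue_inj {p q p' q' : FinPerm} (h : glue p q = glue p' q') : p = p' ∧ q = q' := by
  have hs : p.1 + (1 + q.1) = p'.1 + (1 + q'.1) := congrArg Sigma.fst h
  have hv : ∀ i, val (glue p q) i = val (glue p' q') i := fun i => by rw [h]
  have h1 : p.1 = p'.1 := by
    have hm := val_glue_mid p' q'
    rw [← hv] at hm
    refine val_inj (p := glue p q) (by rw [glue_fst]; omega) (by rw [glue_fst]; omega) ?_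
    rw [hm, val_glue_mid]
    omega
  refine ⟨finPerm_ext h1 fun i hi => ?_, finPerm_ext (by omega) fun i hi => ?_⟩
  · rw [← val_glue_left p q hi, hv, val_glue_left _ _ (by omega)]
  · have := hv (p.1 + (1 + i))
    rw [val_glue_right _ _ hi, h1, val_glue_right _ _ (by omega)] at this
    omega

theorem toPerm_injective : Function.Injective toPerm := by
  intro x
  induction x with
  | nil =>
    intro y h
    cases y with
    | nil => rfl
    | node a l r =>
      have := congrArg Sigma.fst h
      change 0 = (toPerm l).1 + (1 + (toPerm r).1) at this
      omega
  | node a l r hl hr =>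
    intro y h
    cases y with
    | nil =>
      have := congrArg Sigma.fst h
      change (toPerm l).1 + (1 + (toPerm r).1) = 0 at this
      omega
    | node b l' r' =>
      obtain ⟨h1, h2⟩ := glue_inj h
      rw [hl h1, hr h2]

theorem avoidsF_toPerm (x : BinaryTree Unit) : AvoidsF (toPerm x) := by
  induction x with
  | nil => rintro ⟨i, -⟩; exact i.elim0
  | node a l r hl hr => exact avoidsF_glue.2 ⟨hl, hr⟩

/-- A permutation with prescribed values. -/
theorem exists_finPerm (n : ℕ) (f : ℕ → ℕ) (hf : ∀ i < n, f i < n)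
    (hinj : ∀ i < n, ∀ j < n, f i = f j → i = j) :
    ∃ p : FinPerm, p.1 = n ∧ ∀ i < n, val p i = f i := by
  let g : Fin n → Fin n := fun i => ⟨f i, hf i i.2⟩
  have hg : Function.Injective g := fun i j h =>
    Fin.ext (hinj i i.2 j j.2 (congrArg Fin.val h))
  refine ⟨⟨n, Equiv.ofBijective g (Finite.injective_iff_bijective.1 hg)⟩, rfl, fun i hi => ?_⟩
  rw [val_of_lt (p := ⟨n, _⟩) hi]
  rfl

theorem exists_glue_of_avoidsF {p : FinPerm} (h : AvoidsF p) (hp : 0 < p.1) :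
    ∃ l r, p = glue l r := by
  rw [avoidsF_iff] at h
  obtain ⟨n, hn⟩ : ∃ n, p.1 = n + 1 := ⟨p.1 - 1, by omega⟩
  obtain ⟨m, hm, hmv⟩ : ∃ m < p.1, val p m = n := by
    let y : Fin p.1 := ⟨n, by omega⟩
    refine ⟨p.2.symm y, (p.2.symm y).2, ?_⟩
    rw [← coe_apply_eq_val]
    simp [y]
  have hlt : ∀ i < p.1, i ≠ m → val p i < n := fun i hi him => by
    have h1 := val_lt hi
    have h2 : val p i ≠ n := fun h2 => him (val_inj hi hm (h2.trans hmv.symm))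
    omega
  have hsep : ∀ i < m, ∀ j, m < j → j < p.1 → val p i < val p j := by
    intro i hi j hj hj'
    by_contra hc
    have h1 : val p j ≠ val p i := fun h1 => by
      have := val_inj hj' (by omega) h1
      omega
    exact h i m j hi hj hj' (by omega) (by rw [hmv]; exact hlt i (by omega) (by omega))
  have hleft : ∀ i < m, val p i < m := by
    intro i hi
    by_contra hc
    have hcard := Finset.card_le_card_of_injOn (s := Finset.Ioo m p.1)
      (t := Finset.Ioo (val p i) n) (val p)
      (fun j hj => by
        simp only [Finset.coe_Ioo, Set.mem_Ioo] at hj ⊢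
        exact ⟨hsep i hi j hj.1 hj.2, hlt j hj.2 (by omega)⟩)
      (fun a ha b hb hab => by
        simp only [Finset.coe_Ioo, Set.mem_Ioo] at ha hb
        exact val_inj ha.2 hb.2 hab)
    have h1 := hlt i (by omega) (by omega)
    simp only [Nat.card_Ioo] at hcard
    omega
  have hright : ∀ j, m < j → j < p.1 → m ≤ val p j := by
    intro j hj hj'
    by_contra hc
    obtain ⟨i, hi, hij⟩ : ∃ i ∈ Finset.range m, val p i = val p j :=
      Finset.surj_on_of_inj_on_of_card_le (s := Finset.range m) (t := Finset.range m)
        (fun i _ => val p i) (fun i hi => by simpa using hleft i (by simpa using hi))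
        (fun a b ha hb hab => by
          simp only [Finset.mem_range] at ha hb
          exact val_inj (by omega) (by omega) hab) le_rfl (val p j) (by simpa using hc)
        |>.imp fun i hi => ⟨hi.1, hi.2.symm⟩
    simp only [Finset.mem_range] at hi
    have := val_inj (by omega) hj' hij
    omega
  obtain ⟨l, hl, hlv⟩ := exists_finPerm m (val p) hleft
    fun i hi j hj hij => val_inj (by omega) (by omega) hij
  obtain ⟨r, hr, hrv⟩ := exists_finPerm (n - m) (fun j => val p (m + (1 + j)) - m)
    (fun j hj => by
      have h1 := hlt (m + (1 + j)) (by omega) (by omega)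
      have h2 := hright (m + (1 + j)) (by omega) (by omega)
      omega)
    (fun i hi j hj hij => by
      have h1 := hright (m + (1 + i)) (by omega) (by omega)
      have h2 := hright (m + (1 + j)) (by omega) (by omega)
      have := val_inj (p := p) (i := m + (1 + i)) (j := m + (1 + j)) (by omega) (by omega)
        (by omega)
      omega)
  refine ⟨l, r, finPerm_ext (by rw [glue_fst]; omega) fun i hi => ?_⟩
  rcases glue_cases (p := l) (q := r) (i := i) (by rw [glue_fst]; omega) with h1 | rfl | ⟨j, hj, rfl⟩
  · rw [val_glue_left _ _ h1, hlv _ (by omega)]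
  · rw [val_glue_mid, hl, hmv]
    omega
  · rw [val_glue_right _ _ hj, hrv _ (by omega), hl]
    have h2 := hright (m + (1 + j)) (by omega) (by omega)
    omega

theorem exists_toPerm_eq {p : FinPerm} (h : AvoidsF p) : ∃ x, toPerm x = p := by
  obtain ⟨n, hn⟩ : ∃ n, n = p.1 := ⟨_, rfl⟩
  induction n using Nat.strong_induction_on generalizing p with
  | _ n ih =>
    rcases Nat.eq_zero_or_pos p.1 with h0 | h0
    · exact ⟨.nil, finPerm_ext h0.symm fun i hi => absurd hi (Nat.not_lt_zero i)⟩
    · obtain ⟨l, r, rfl⟩ := exists_glue_of_avoidsF h h0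
      rw [glue_fst] at hn
      obtain ⟨hl, hr⟩ := avoidsF_glue.1 h
      obtain ⟨x, rfl⟩ := ih l.1 (by omega) hl rfl
      obtain ⟨y, rfl⟩ := ih r.1 (by omega) hr rfl
      exact ⟨.node () x y, rfl⟩

open Classical in
theorem cnt_eq_card (k : ℕ) (t : QT k) (n : ℕ) :
    cnt k t n = ((BinaryTree.treesOfNumNodesEq n).filter fun x => typeOf k (toPerm x) = t).card := by
  rw [cnt, ← Fintype.card_coe, ← Nat.card_eq_fintype_card]
  have hex : ∀ σ : {σ : Equiv.Perm (Fin n) // Avoids σ ∧ typeOf k ⟨n, σ⟩ = t},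
      ∃ x, toPerm x = ⟨n, σ.1⟩ := fun σ => exists_toPerm_eq σ.2.1
  choose f hf using hex
  refine Nat.card_eq_of_bijective (fun σ => ⟨f σ, Finset.mem_filter.2 ⟨?_, ?_⟩⟩) ⟨?_, ?_⟩
  · rw [BinaryTree.mem_treesOfNumNodesEq, ← toPerm_fst, hf]
  · rw [hf]
    exact σ.2.2
  · intro σ τ h
    have h1 : f σ = f τ := congrArg Subtype.val h
    have h2 : (⟨n, σ.1⟩ : FinPerm) = ⟨n, τ.1⟩ := by rw [← hf, ← hf, h1]
    exact Subtype.ext (by simpa using h2)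
  · rintro ⟨x, hx⟩
    obtain ⟨h1, h2⟩ := Finset.mem_filter.1 hx
    rw [BinaryTree.mem_treesOfNumNodesEq, ← toPerm_fst] at h1
    obtain ⟨σ, hσ⟩ : ∃ σ, toPerm x = ⟨n, σ⟩ := by
      subst h1
      exact ⟨_, rfl⟩
    have hav : AvoidsF ⟨n, σ⟩ := hσ ▸ avoidsF_toPerm x
    refine ⟨⟨σ, hav, hσ ▸ h2⟩, Subtype.ext (toPerm_injective ?_)⟩
    exact (hf _).trans hσ.symm

/-! ### Catalan numbers -/

theorem catalan_pos (n : ℕ) : (0 : ℝ) < catalan n := by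
  have h := succ_mul_catalan_eq_centralBinom n
  have := Nat.centralBinom_pos n
  rw [← h] at this
  exact_mod_cast Nat.pos_of_mul_pos_left this

theorem catalan_succ_ratio (n : ℕ) :
    ((n : ℝ) + 2) * catalan (n + 1) = (4 * n + 2) * catalan n := by
  have h1 := succ_mul_catalan_eq_centralBinom n
  have h2 := succ_mul_catalan_eq_centralBinom (n + 1)
  have h3 := Nat.succ_mul_centralBinom_succ n
  rw [← h1, ← h2] at h3
  have h4 : ((n : ℝ) + 1) * ((n + 1 + 1) * catalan (n + 1)) =
      2 * (2 * n + 1) * ((n + 1) * catalan n) := by exact_mod_cast h3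
  have h5 : ((n : ℝ) + 1) ≠ 0 := by positivity
  apply mul_left_cancel₀ h5
  linarith

theorem sum_catalan (J : ℕ) : ∑ i ∈ Finset.range J, 2 * (catalan i : ℝ) / 4 ^ (i + 1) =
    1 - (J.centralBinom : ℝ) / 4 ^ J := by
  induction J with
  | zero => simp
  | succ J ih =>
    rw [Finset.sum_range_succ, ih]
    have h1 : ((J : ℝ) + 1) * catalan J = J.centralBinom := by
      exact_mod_cast succ_mul_catalan_eq_centralBinom J
    have h2 : ((J : ℝ) + 1) * (J + 1).centralBinom = 2 * (2 * J + 1) * J.centralBinom := by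
      exact_mod_cast Nat.succ_mul_centralBinom_succ J
    have h3 : ((J + 1).centralBinom : ℝ) = 2 * (2 * J + 1) * catalan J := by
      have h5 : ((J : ℝ) + 1) ≠ 0 := by positivity
      apply mul_left_cancel₀ h5
      rw [h2, ← h1]; ring
    rw [h3, ← h1]
    field_simp
    ring

theorem tendsto_centralBinom_mul_sqrt :
    Tendsto (fun n : ℕ => (n.centralBinom : ℝ) * √n / 4 ^ n) atTop (𝓝 (1 / √Real.pi)) := by
  have h1 := Stirling.tendsto_stirlingSeq_sqrt_pi
  have h2 : Tendsto (fun n : ℕ => 2 * n) atTop atTop :=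
    tendsto_id.const_mul_atTop' (by norm_num)
  have hpi : √Real.pi ≠ 0 := by positivity
  have h3 := (h1.comp h2).div (h1.pow 2) (pow_ne_zero 2 hpi)
  have h4 : √Real.pi / √Real.pi ^ 2 = 1 / √Real.pi := by field_simp
  rw [h4] at h3
  refine h3.congr' ?_
  filter_upwards [eventually_gt_atTop 0] with n hn
  have hn' : (0 : ℝ) < n := by exact_mod_cast hn
  have hfac : ((2 * n).factorial : ℝ) = n.centralBinom * (n.factorial : ℝ) ^ 2 := by
    have := Nat.choose_mul_factorial_mul_factorial (show n ≤ 2 * n by omega)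
    rw [show 2 * n - n = n by omega] at this
    rw [Nat.centralBinom_eq_two_mul_choose, ← this]
    push_cast
    ring
  have hs : √(2 * ((2 * n : ℕ) : ℝ)) = 2 * √n := by
    rw [show (2 * ((2 * n : ℕ) : ℝ)) = 2 ^ 2 * n by push_cast; ring, Real.sqrt_mul (by positivity),
      Real.sqrt_sq (by norm_num)]
  have hs2 : √(2 * (n : ℝ)) ^ 2 = 2 * n := Real.sq_sqrt (by positivity)
  have hs3 : √(n : ℝ) * √n = n := Real.mul_self_sqrt hn'.le
  have hpow : (((2 * n : ℕ) : ℝ) / Real.exp 1) ^ (2 * n) = 4 ^ n * ((n / Real.exp 1) ^ n) ^ 2 := by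
    rw [show ((2 * n : ℕ) : ℝ) / Real.exp 1 = 2 * (n / Real.exp 1) by push_cast; ring, mul_pow,
      pow_mul (2 : ℝ) 2 n, mul_comm 2 n, pow_mul _ n 2]
    norm_num
  have hne : 0 < ((n : ℝ) / Real.exp 1) ^ n := by positivity
  simp only [Pi.div_apply, Function.comp, Stirling.stirlingSeq]
  rw [hfac, hs, hpow]
  generalize ((n : ℝ) / Real.exp 1) ^ n = z at hne
  rw [div_pow, mul_pow, hs2, div_div_div_eq, div_eq_div_iff (by positivity) (by positivity)]
  linear_combination (-(2 : ℝ) * n.centralBinom * n.factorial ^ 2 * z ^ 2 * 4 ^ n) * hs3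

theorem tendsto_centralBinom_div :
    Tendsto (fun n : ℕ => (n.centralBinom : ℝ) / 4 ^ n) atTop (𝓝 0) := by
  have h1 : Tendsto (fun n : ℕ => √(n : ℝ)) atTop atTop :=
    Real.tendsto_sqrt_atTop.comp tendsto_natCast_atTop_atTop
  have h2 := tendsto_centralBinom_mul_sqrt.mul h1.inv_tendsto_atTop
  rw [mul_zero] at h2
  refine h2.congr' ?_
  filter_upwards [eventually_gt_atTop 0] with n hn
  have : √(n : ℝ) ≠ 0 := by positivity
  simp only [Pi.inv_apply]
  field_simp

theorem tendsto_catalan_div :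
    Tendsto (fun n : ℕ => (catalan n : ℝ) / (4 ^ n * (n : ℝ) ^ (-(3 : ℝ) / 2))) atTop
      (𝓝 (1 / √Real.pi)) := by
  have h1 : Tendsto (fun n : ℕ => (n : ℝ) / (n + 1)) atTop (𝓝 1) :=
    tendsto_natCast_div_add_atTop 1
  have h2 := tendsto_centralBinom_mul_sqrt.mul h1
  rw [mul_one] at h2
  refine h2.congr' ?_
  filter_upwards [eventually_gt_atTop 0] with n hn
  have hn' : (0 : ℝ) < n := by exact_mod_cast hn
  have h3 : ((n : ℝ) + 1) * catalan n = n.centralBinom := by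
    exact_mod_cast succ_mul_catalan_eq_centralBinom n
  have h4 : (n : ℝ) ^ (-(3 : ℝ) / 2) = (n * √n)⁻¹ := by
    rw [show (-(3 : ℝ) / 2) = -(1 + 1 / 2) by norm_num, Real.rpow_neg hn'.le,
      Real.rpow_add hn', Real.rpow_one, Real.sqrt_eq_rpow]
  rw [h4, ← h3]
  field_simp

theorem tendsto_catalan_ratio (i : ℕ) :
    Tendsto (fun n : ℕ => (catalan (n - i) : ℝ) / catalan (n + 1)) atTop (𝓝 (1 / 4 ^ (i + 1))) := by
  have hone : Tendsto (fun n : ℕ => (catalan n : ℝ) / catalan (n + 1)) atTop (𝓝 (1 / 4)) := by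
    have h1 : Tendsto (fun n : ℕ => 1 / 4 * ((n : ℝ) + 1 / 2 + 3 / 2) / (n + 1 / 2)) atTop
        (𝓝 (1 / 4)) := by
      have h2 : Tendsto (fun n : ℕ => (n : ℝ) + 1 / 2) atTop atTop :=
        tendsto_atTop_add_const_right _ _ tendsto_natCast_atTop_atTop
      have h3 := (h2.const_div_atTop (3 / 8)).const_add (1 / 4)
      rw [add_zero] at h3
      refine h3.congr fun n => ?_
      have : (n : ℝ) + 1 / 2 ≠ 0 := by positivity
      field_simp
      ring
    refine h1.congr fun n => ?_
    have h4 := catalan_succ_ratio n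
    have h5 := catalan_pos (n + 1)
    have : (n : ℝ) + 1 / 2 ≠ 0 := by positivity
    rw [div_eq_div_iff (by positivity) (by positivity)]
    linarith
  induction i with
  | zero => simpa using hone
  | succ i ih =>
    have h1 := ih.mul (hone.comp (tendsto_sub_atTop_nat (i + 1)))
    rw [show (1 : ℝ) / 4 ^ (i + 1) * (1 / 4) = 1 / 4 ^ (i + 1 + 1) by ring] at h1
    refine h1.congr' ?_
    filter_upwards [eventually_ge_atTop (i + 1)] with n hn
    have h2 : n - i = n - (i + 1) + 1 := by omega
    have h3 := catalan_pos (n - (i + 1) + 1)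
    simp only [Function.comp]
    rw [h2]
    field_simp

/-! ### Recursive labellings of binary trees -/

section Labelling

open BinaryTree

theorem sum_range_eq_sum_ends_add (a : ℕ → ℝ) {n J : ℕ} (hJ : 2 * J ≤ n + 1) :
    ∑ i ∈ Finset.range (n + 1), a i =
      ∑ i ∈ Finset.range J, (a i + a (n - i)) + ∑ i ∈ Finset.Ico J (n + 1 - J), a i := by
  rw [Finset.sum_add_distrib, Finset.range_eq_Ico, Finset.range_eq_Ico,
    Finset.sum_Ico_reflect a 0 (by omega : J ≤ n + 1), Nat.sub_zero,
    ← Finset.sum_Ico_consecutive a (Nat.zero_le J) (by omega : J ≤ n + 1),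
    ← Finset.sum_Ico_consecutive a (by omega : J ≤ n + 1 - J) (Nat.sub_le _ _)]
  ring

theorem sum_treesOfNumNodesEq_succ (F : BinaryTree Unit → ℝ) (n : ℕ) :
    ∑ x ∈ treesOfNumNodesEq (n + 1), F x = ∑ i ∈ Finset.range (n + 1),
      ∑ l ∈ treesOfNumNodesEq i, ∑ r ∈ treesOfNumNodesEq (n - i), F (.node () l r) := by
  rw [treesOfNumNodesEq_succ, Finset.sum_biUnion, Finset.Nat.sum_antidiagonal_eq_sum_range_succ_mk]
  · simp only [Finset.sum_map, Finset.sum_product]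
    rfl
  · simp_rw [Set.PairwiseDisjoint, Set.Pairwise, Function.onFun, Finset.disjoint_left]
    aesop

variable {Q : Type*} (s : BinaryTree Unit → Q) (h : Q → Q → Q)

/-- The average of `g ∘ s` over the binary trees with `n` nodes. -/
noncomputable def mean (g : Q → ℝ) (n : ℕ) : ℝ :=
  (∑ x ∈ treesOfNumNodesEq n, g (s x)) / catalan n

/-- The sum of the values of `g` at the labels obtained by combining `u`, on either side, with
the label of a tree with `i` nodes. -/
noncomputable def sibSum (g : Q → ℝ) (i : ℕ) (u : Q) : ℝ :=
  ∑ y ∈ treesOfNumNodesEq i, (g (h (s y) u) + g (h u (s y)))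

variable {s h}

theorem abs_mean_succ_sub_le (hs : ∀ l r, s (.node () l r) = h (s l) (s r)) {g : Q → ℝ}
    (hg : ∀ q, |g q| ≤ 1) {n J : ℕ} (hJ : 2 * J ≤ n + 1) :
    |mean s g (n + 1) - ∑ i ∈ Finset.range J,
        (catalan (n - i) : ℝ) / catalan (n + 1) * mean s (sibSum s h g i) (n - i)| ≤
      1 - ∑ i ∈ Finset.range J, 2 * (catalan i : ℝ) * (catalan (n - i) / catalan (n + 1)) := by
  set a : ℕ → ℝ := fun i => ∑ l ∈ treesOfNumNodesEq i, ∑ r ∈ treesOfNumNodesEq (n - i),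
    g (h (s l) (s r)) with ha
  have hpos := catalan_pos (n + 1)
  have hsum : mean s g (n + 1) = (∑ i ∈ Finset.range (n + 1), a i) / catalan (n + 1) := by
    simp only [mean, sum_treesOfNumNodesEq_succ, hs, ha]
  have hcat : (catalan (n + 1) : ℝ) =
      ∑ i ∈ Finset.range (n + 1), (catalan i : ℝ) * catalan (n - i) := by
    rw [catalan_succ', Finset.Nat.sum_antidiagonal_eq_sum_range_succ_mk]
    push_cast
    rfl
  have habs : ∀ i, |a i| ≤ (catalan i : ℝ) * catalan (n - i) := by
    intro i
    rw [← treesOfNumNodesEq_card_eq_catalan i, ← treesOfNumNodesEq_card_eq_catalan (n - i)]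
    refine (Finset.abs_sum_le_sum_abs _ _).trans ?_
    rw [← nsmul_eq_mul]
    refine Finset.sum_le_card_nsmul _ _ _ fun l _ => (Finset.abs_sum_le_sum_abs _ _).trans ?_
    simpa using Finset.sum_le_card_nsmul _ (fun r => |g (h (s l) (s r))|) 1 fun r _ => hg _
  have hend : ∀ i ∈ Finset.range J, (catalan (n - i) : ℝ) / catalan (n + 1) *
      mean s (sibSum s h g i) (n - i) = (a i + a (n - i)) / catalan (n + 1) := by
    intro i hi
    have h1 : n - (n - i) = i := by have := Finset.mem_range.1 hi; omega
    have h2 := catalan_pos (n - i)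
    have h3 : a i + a (n - i) = ∑ x ∈ treesOfNumNodesEq (n - i), sibSum s h g i (s x) := by
      simp only [ha, h1, sibSum, Finset.sum_add_distrib]
      rw [Finset.sum_comm]
    rw [h3, mean]
    field_simp
  rw [sum_range_eq_sum_ends_add _ hJ] at hsum hcat
  rw [Finset.sum_congr rfl hend, hsum, ← Finset.sum_div, ← sub_div, add_sub_cancel_left, abs_div,
    abs_of_pos hpos, div_le_iff₀ hpos, sub_mul, Finset.sum_mul, one_mul]
  have h4 : ∀ i ∈ Finset.range J, 2 * (catalan i : ℝ) * (catalan (n - i) / catalan (n + 1)) *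
      catalan (n + 1) = (catalan i : ℝ) * catalan (n - i) +
        (catalan (n - i) : ℝ) * catalan (n - (n - i)) := by
    intro i hi
    have h1 : n - (n - i) = i := by have := Finset.mem_range.1 hi; omega
    rw [h1]
    field_simp
    ring
  rw [Finset.sum_congr rfl h4]
  have h5 : |∑ i ∈ Finset.Ico J (n + 1 - J), a i| ≤
      ∑ i ∈ Finset.Ico J (n + 1 - J), (catalan i : ℝ) * catalan (n - i) :=
    (Finset.abs_sum_le_sum_abs _ _).trans (Finset.sum_le_sum fun i _ => habs i)
  linarith

theorem abs_sibSum_le {g : Q → ℝ} (hg : ∀ q, |g q| ≤ 1) (i : ℕ) (u : Q) :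
    |sibSum s h g i u| ≤ 2 * catalan i := by
  rw [← treesOfNumNodesEq_card_eq_catalan i, mul_comm, ← nsmul_eq_mul]
  refine (Finset.abs_sum_le_sum_abs _ _).trans (Finset.sum_le_card_nsmul _ _ _ fun y _ => ?_)
  refine (abs_add_le _ _).trans ?_
  linarith [hg (h (s y) u), hg (h u (s y))]

section Ancestral

variable [Fintype Q]

variable (s h) in
/-- The family `d`, indexed by generations, satisfies the truncated recursion expressing
generation `j` through its successors, up to twice the tail of the Catalan series. -/
def AncestralBound (d : ℕ → Q → ℝ) : Prop :=
  ∀ g : Q → ℝ, (∀ q, |g q| ≤ 1) → ∀ j J, |∑ q, g q * d j q -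
    ∑ i ∈ Finset.range J, 1 / 4 ^ (i + 1) * ∑ q, sibSum s h g i q * d (j + 1 + i) q| ≤
      2 * ((J.centralBinom : ℝ) / 4 ^ J)

theorem AncestralBound.neg {d : ℕ → Q → ℝ} (hd : AncestralBound s h d) :
    AncestralBound s h fun j q => -d j q := by
  intro g hg j J
  have h1 := hd g hg j J
  rw [← abs_neg] at h1
  simp only [mul_neg, Finset.sum_neg_distrib]
  rwa [neg_sub_neg, ← neg_sub]

theorem AncestralBound.sub {p p' : ℕ → Q → ℝ}
    (hp : ∀ g : Q → ℝ, (∀ q, |g q| ≤ 1) → ∀ j J, |∑ q, g q * p j q -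
        ∑ i ∈ Finset.range J, 1 / 4 ^ (i + 1) * ∑ q, sibSum s h g i q * p (j + 1 + i) q| ≤
          (J.centralBinom : ℝ) / 4 ^ J)
    (hp' : ∀ g : Q → ℝ, (∀ q, |g q| ≤ 1) → ∀ j J, |∑ q, g q * p' j q -
        ∑ i ∈ Finset.range J, 1 / 4 ^ (i + 1) * ∑ q, sibSum s h g i q * p' (j + 1 + i) q| ≤
          (J.centralBinom : ℝ) / 4 ^ J) :
    AncestralBound s h fun j q => p j q - p' j q := by
  intro g hg j J
  have h1 := hp g hg j J
  have h2 := hp' g hg j J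
  simp only [mul_sub, Finset.sum_sub_distrib]
  rw [abs_le] at h1 h2 ⊢
  constructor <;> linarith [h1.1, h1.2, h2.1, h2.2]

theorem AncestralBound.step {d : ℕ → Q → ℝ} (hd : AncestralBound s h d) {D : ℝ} (hD : 0 < D)
    (hle : ∀ j, ∑ q, |d j q| ≤ D) {j : ℕ} (hj : ∑ q, |d j q| = D) (i : ℕ) :
    ∑ q, |d (j + 1 + i) q| = D ∧ ∀ q, 0 < d (j + 1 + i) q → ∀ y ∈ treesOfNumNodesEq i,
      0 < d j (h (s y) q) ∧ 0 < d j (h q (s y)) := by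
  set g : Q → ℝ := fun q => if 0 < d j q then 1 else -1 with hgdef
  have hg : ∀ q, |g q| ≤ 1 := by
    intro q
    simp only [hgdef]
    split_ifs <;> simp
  have hg1 : ∀ q, g q ≤ 1 := fun q => (abs_le.1 (hg q)).2
  have hgd : ∑ q, g q * d j q = D := by
    rw [← hj]
    refine Finset.sum_congr rfl fun q _ => ?_
    simp only [hgdef]
    split_ifs with h1
    · rw [one_mul, abs_of_pos h1]
    · rw [abs_of_nonpos (not_lt.1 h1), neg_one_mul]
  have hterm : ∀ i q, sibSum s h g i q * d (j + 1 + i) q ≤ 2 * catalan i * |d (j + 1 + i) q| := by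
    intro i q
    refine (le_abs_self _).trans ?_
    rw [abs_mul]
    exact mul_le_mul_of_nonneg_right (abs_sibSum_le hg i q) (abs_nonneg _)
  have hx : ∀ i, ∑ q, sibSum s h g i q * d (j + 1 + i) q ≤ 2 * catalan i * D := by
    intro i
    refine (Finset.sum_le_sum fun q _ => hterm i q).trans ?_
    rw [← Finset.mul_sum]
    exact mul_le_mul_of_nonneg_left (hle _) (by positivity)
  have hge : 2 * catalan i * D ≤ ∑ q, sibSum s h g i q * d (j + 1 + i) q := by
    set gap : ℕ → ℝ := fun i =>
      1 / 4 ^ (i + 1) * (2 * catalan i * D - ∑ q, sibSum s h g i q * d (j + 1 + i) q) with hgap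
    have hgap0 : ∀ i, 0 ≤ gap i := fun i => mul_nonneg (by positivity) (sub_nonneg.2 (hx i))
    have hlim : gap i ≤ 2 * 0 := by
      refine ge_of_tendsto (tendsto_centralBinom_div.const_mul 2) ?_
      filter_upwards [eventually_gt_atTop i] with J hJ
      have h1 := (abs_le.1 (hd g hg j J)).2
      have h2 : ∑ i ∈ Finset.range J, gap i = (1 - (J.centralBinom : ℝ) / 4 ^ J) * D -
          ∑ i ∈ Finset.range J, 1 / 4 ^ (i + 1) *
            ∑ q, sibSum s h g i q * d (j + 1 + i) q := by
        rw [← sum_catalan, Finset.sum_mul, ← Finset.sum_sub_distrib]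
        refine Finset.sum_congr rfl fun i _ => ?_
        simp only [hgap]
        ring
      have h3 : gap i ≤ ∑ i ∈ Finset.range J, gap i :=
        Finset.single_le_sum (fun i _ => hgap0 i) (Finset.mem_range.2 hJ)
      have h4 : 0 ≤ (J.centralBinom : ℝ) / 4 ^ J * D := by positivity
      rw [hgd] at h1
      linarith
    have h5 : 0 < (1 : ℝ) / 4 ^ (i + 1) := by positivity
    by_contra hlt
    have := mul_pos h5 (sub_pos.2 (not_le.1 hlt))
    simp only [hgap] at hlim
    linarith
  have hcat := catalan_pos i
  have hsum : ∑ q, sibSum s h g i q * d (j + 1 + i) q ≤ 2 * catalan i * ∑ q, |d (j + 1 + i) q| := by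
    rw [Finset.mul_sum]
    exact Finset.sum_le_sum fun q _ => hterm i q
  refine ⟨le_antisymm (hle _) (le_of_mul_le_mul_left (hge.trans hsum) (by positivity)), ?_⟩
  intro q hq y hy
  have hzero : ∑ q, (2 * catalan i * |d (j + 1 + i) q| - sibSum s h g i q * d (j + 1 + i) q) = 0 := by
    refine le_antisymm ?_ (Finset.sum_nonneg fun q _ => sub_nonneg.2 (hterm i q))
    rw [Finset.sum_sub_distrib, ← Finset.mul_sum]
    have := mul_le_mul_of_nonneg_left (hle (j + 1 + i)) (by positivity : (0 : ℝ) ≤ 2 * catalan i)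
    linarith
  have hq0 := (Finset.sum_eq_zero_iff_of_nonneg fun q _ => sub_nonneg.2 (hterm i q)).1 hzero q
    (Finset.mem_univ q)
  rw [abs_of_pos hq, ← sub_mul, mul_eq_zero, or_iff_left hq.ne'] at hq0
  have hy0 : ∑ y ∈ treesOfNumNodesEq i, (2 - (g (h (s y) q) + g (h q (s y)))) = 0 := by
    rw [Finset.sum_sub_distrib, Finset.sum_const, treesOfNumNodesEq_card_eq_catalan, nsmul_eq_mul,
      mul_comm]
    exact hq0
  have hy1 := (Finset.sum_eq_zero_iff_of_nonneg fun y _ => by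
    linarith [hg1 (h (s y) q), hg1 (h q (s y))]).1 hy0 y hy
  have hgpos : ∀ u, 1 ≤ g u → 0 < d j u := by
    intro u hu
    by_contra hn
    simp only [hgdef, if_neg hn] at hu
    linarith
  exact ⟨hgpos _ (by linarith [hg1 (h (s y) q), hg1 (h q (s y))]),
    hgpos _ (by linarith [hg1 (h (s y) q), hg1 (h q (s y))])⟩

theorem AncestralBound.iterate_pos {d : ℕ → Q → ℝ} (hd : AncestralBound s h d) {D : ℝ}
    (hD : 0 < D) (heq : ∀ j, ∑ q, |d j q| = D) (m : ℕ) {q : Q} (hq : 0 < d m q) :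
    0 < d 0 ((fun q => h q (s .nil))^[m] q) := by
  induction m generalizing q with
  | zero => exact hq
  | succ m ih =>
    rw [Function.iterate_succ_apply]
    exact ih ((hd.step hD (fun j => (heq j).le) (heq m) 0).2 q hq .nil (by simp)).2

theorem AncestralBound.not_pos (hsurj : Function.Surjective s) {N₀ : ℕ}
    (hper : ∀ N, N₀ ≤ N → ∀ q, (fun q => h q (s .nil))^[N + 1] q = (fun q => h q (s .nil))^[N] q)
    {d : ℕ → Q → ℝ} (hd : AncestralBound s h d) {D : ℝ} (hle : ∀ j, ∑ q, |d j q| ≤ D)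
    (h0 : ∑ q, |d 0 q| = D) (hsum : ∀ j, ∑ q, d j q = 0) : ¬ 0 < D := by
  intro hD
  have heq : ∀ j, ∑ q, |d j q| = D := by
    intro j
    induction j with
    | zero => exact h0
    | succ j ih => exact (hd.step hD hle ih 0).1
  have hstable : ∀ N, N₀ ≤ N → ∀ q,
      (fun q => h q (s .nil))^[N] q = (fun q => h q (s .nil))^[N₀] q := by
    intro N hN q
    induction N, hN using Nat.le_induction with
    | base => rfl
    | succ N hN ih => rw [hper N hN, ih]
  choose y hy using hsurj
  set B := ∑ q, (y q).numNodes with hB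
  have hyB : ∀ q, (y q).numNodes ≤ B := fun q =>
    Finset.single_le_sum (f := fun q => (y q).numNodes) (fun _ _ => Nat.zero_le _)
      (Finset.mem_univ q)
  obtain ⟨u, hu⟩ : ∃ u, 0 < d (N₀ + B + 1) u := by
    by_contra! hn
    have h1 : ∑ q, |d (N₀ + B + 1) q| = -∑ q, d (N₀ + B + 1) q := by
      rw [← Finset.sum_neg_distrib]
      exact Finset.sum_congr rfl fun q _ => abs_of_nonpos (hn q)
    rw [heq, hsum] at h1
    linarith
  obtain ⟨v, hv⟩ : ∃ v, d (N₀ + B + 1) v < 0 := by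
    by_contra! hn
    have h1 : ∑ q, |d (N₀ + B + 1) q| = ∑ q, d (N₀ + B + 1) q :=
      Finset.sum_congr rfl fun q _ => abs_of_nonneg (hn q)
    rw [heq, hsum] at h1
    linarith
  have hpos : 0 < d 0 ((fun q => h q (s .nil))^[N₀] (h u v)) := by
    have hJ : N₀ + B + 1 = N₀ + B - (y v).numNodes + 1 + (y v).numNodes := by
      have := hyB v
      omega
    rw [hJ] at hu
    have h1 := ((hd.step hD hle (heq _) _).2 u hu (y v) (mem_treesOfNumNodesEq_numNodes _)).2
    rw [hy] at h1
    have h2 := hd.iterate_pos hD heq _ h1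
    rwa [hstable _ (by have := hyB v; omega)] at h2
  have hneg : 0 < -d 0 ((fun q => h q (s .nil))^[N₀] (h u v)) := by
    have heq' : ∀ j, ∑ q, |-d j q| = D := by simpa only [abs_neg] using heq
    have hJ : N₀ + B + 1 = N₀ + B - (y u).numNodes + 1 + (y u).numNodes := by
      have := hyB u
      omega
    rw [hJ] at hv
    have h1 := ((hd.neg.step hD (fun j => (heq' j).le) (heq' _) _).2 v (neg_pos.2 hv) (y u)
      (mem_treesOfNumNodesEq_numNodes _)).1
    rw [hy] at h1
    have h2 := hd.neg.iterate_pos hD heq' _ h1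
    rwa [hstable _ (by have := hyB u; omega)] at h2
  linarith

end Ancestral

variable [DecidableEq Q]

variable (s) in
/-- The proportion of trees with label `q` among the binary trees with `n` nodes. -/
noncomputable def freq (n : ℕ) (q : Q) : ℝ :=
  ((treesOfNumNodesEq n).filter fun x => s x = q).card / (catalan n : ℝ)

theorem freq_nonneg (n : ℕ) (q : Q) : 0 ≤ freq s n q := by
  unfold freq
  positivity

theorem pos_of_card_filter_le {ℓ : Q → ℝ} (hℓ : ∀ q, Tendsto (fun n => freq s n q) atTop (𝓝 (ℓ q)))
    {u t : Q} (i : ℕ)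
    (hcard : ∀ n, ((treesOfNumNodesEq n).filter fun x => s x = u).card ≤
      ((treesOfNumNodesEq (n + i + 1)).filter fun x => s x = t).card)
    (hu : 0 < ℓ u) : 0 < ℓ t := by
  have h1 := (tendsto_catalan_ratio i).mul ((hℓ u).comp (tendsto_sub_atTop_nat i))
  have h2 := (hℓ t).comp (tendsto_add_atTop_nat 1)
  refine lt_of_lt_of_le (by positivity) (le_of_tendsto_of_tendsto h1 h2 ?_)
  filter_upwards [eventually_ge_atTop i] with n hn
  have h3 := hcard (n - i)
  rw [show n - i + i + 1 = n + 1 by omega] at h3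
  have h4 := catalan_pos (n - i)
  have h5 := catalan_pos (n + 1)
  have h6 : (((treesOfNumNodesEq (n - i)).filter fun x => s x = u).card : ℝ) ≤
      ((treesOfNumNodesEq (n + 1)).filter fun x => s x = t).card := by exact_mod_cast h3
  simp only [Function.comp, freq]
  rw [mul_comm, div_mul_div_cancel₀ h4.ne']
  exact div_le_div_of_nonneg_right h6 h5.le

theorem limit_freq_pos_left (hs : ∀ l r, s (.node () l r) = h (s l) (s r))
    (hsurj : Function.Surjective s) {ℓ : Q → ℝ}
    (hℓ : ∀ q, Tendsto (fun n => freq s n q) atTop (𝓝 (ℓ q))) {u : Q} (hu : 0 < ℓ u) (v : Q) :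
    0 < ℓ (h u v) := by
  obtain ⟨y, rfl⟩ := hsurj v
  refine pos_of_card_filter_le hℓ y.numNodes (fun n => ?_) hu
  refine Finset.card_le_card_of_injOn (fun x => .node () x y) (fun x hx => ?_) fun x _ x' _ hx => ?_
  · have h1 := Finset.mem_filter.1 (Finset.mem_coe.1 hx)
    rw [mem_treesOfNumNodesEq] at h1
    refine Finset.mem_coe.2 (Finset.mem_filter.2 ⟨?_, ?_⟩)
    · rw [mem_treesOfNumNodesEq, BinaryTree.numNodes, h1.1]
    · rw [hs, h1.2]
  · exact (BinaryTree.node.inj hx).2.1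

theorem limit_freq_pos_right (hs : ∀ l r, s (.node () l r) = h (s l) (s r))
    (hsurj : Function.Surjective s) {ℓ : Q → ℝ}
    (hℓ : ∀ q, Tendsto (fun n => freq s n q) atTop (𝓝 (ℓ q))) {u : Q} (hu : 0 < ℓ u) (v : Q) :
    0 < ℓ (h v u) := by
  obtain ⟨y, rfl⟩ := hsurj v
  refine pos_of_card_filter_le hℓ y.numNodes (fun n => ?_) hu
  refine Finset.card_le_card_of_injOn (fun x => .node () y x) (fun x hx => ?_) fun x _ x' _ hx => ?_
  · have h1 := Finset.mem_filter.1 (Finset.mem_coe.1 hx)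
    rw [mem_treesOfNumNodesEq] at h1
    refine Finset.mem_coe.2 (Finset.mem_filter.2 ⟨?_, ?_⟩)
    · rw [mem_treesOfNumNodesEq, BinaryTree.numNodes, h1.1, Nat.add_comm n]
    · rw [hs, h1.2]
  · exact (BinaryTree.node.inj hx).2.2

variable [Fintype Q]

theorem mean_eq_sum_freq (g : Q → ℝ) (n : ℕ) : mean s g n = ∑ q, g q * freq s n q := by
  rw [mean, ← Finset.sum_fiberwise _ s, Finset.sum_div]
  refine Finset.sum_congr rfl fun q _ => ?_
  rw [freq, mul_div_assoc', Finset.sum_congr rfl (g := fun _ => g q), Finset.sum_const, nsmul_eq_mul,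
    mul_comm]
  intro x hx
  rw [(Finset.mem_filter.1 hx).2]

theorem sum_freq (n : ℕ) : ∑ q, freq s n q = 1 := by
  have h1 := mean_eq_sum_freq (s := s) (fun _ => 1) n
  simp only [one_mul] at h1
  rw [← h1, mean, Finset.sum_const, treesOfNumNodesEq_card_eq_catalan, nsmul_eq_mul, mul_one,
    div_self (catalan_pos n).ne']

theorem freq_le_one (n : ℕ) (q : Q) : freq s n q ≤ 1 :=
  (Finset.single_le_sum (fun q _ => freq_nonneg n q) (Finset.mem_univ q)).trans_eq (sum_freq n)

theorem exists_limit_freq (hs : ∀ l r, s (.node () l r) = h (s l) (s r)) {ι : Type*}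
    (U : Ultrafilter ι) {N : ι → ℕ} (hN : Tendsto N U atTop) :
    ∃ p : ℕ → Q → ℝ, (∀ j q, Tendsto (fun x => freq s (N x - j) q) U (𝓝 (p j q))) ∧
      ∀ g : Q → ℝ, (∀ q, |g q| ≤ 1) → ∀ j J, |∑ q, g q * p j q -
        ∑ i ∈ Finset.range J, 1 / 4 ^ (i + 1) * ∑ q, sibSum s h g i q * p (j + 1 + i) q| ≤
          (J.centralBinom : ℝ) / 4 ^ J := by
  have hex : ∀ j q, ∃ a, Tendsto (fun x => freq s (N x - j) q) U (𝓝 a) := by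
    intro j q
    have hc : IsCompact (Set.Icc (0 : ℝ) 1) := isCompact_Icc
    obtain ⟨a, -, ha⟩ := hc.ultrafilter_le_nhds (U.map fun x => freq s (N x - j) q)
      (by
        rw [le_principal_iff]
        exact Filter.mem_map.2 <| Filter.univ_mem' fun x => ⟨freq_nonneg (N x - j) q, freq_le_one (N x - j) q⟩)
    exact ⟨a, ha⟩
  choose p hp using hex
  refine ⟨p, hp, fun g hg j J => ?_⟩
  have hmean : ∀ (f : Q → ℝ) (j : ℕ),
      Tendsto (fun x => mean s f (N x - j)) U (𝓝 (∑ q, f q * p j q)) := by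
    intro f j
    simp only [mean_eq_sum_freq]
    exact tendsto_finsetSum _ fun q _ => (hp j q).const_mul _
  have hsub : Tendsto (fun x => N x - (j + 1)) U atTop := (tendsto_sub_atTop_nat _).comp hN
  have hratio : ∀ i, Tendsto (fun x => (catalan (N x - (j + 1) - i) : ℝ) /
      catalan (N x - (j + 1) + 1)) U (𝓝 (1 / 4 ^ (i + 1))) :=
    fun i => (tendsto_catalan_ratio i).comp hsub
  have hrhs : Tendsto (fun x => 1 - ∑ i ∈ Finset.range J, 2 * (catalan i : ℝ) *
      (catalan (N x - (j + 1) - i) / catalan (N x - (j + 1) + 1))) U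
        (𝓝 ((J.centralBinom : ℝ) / 4 ^ J)) := by
    have h1 : (J.centralBinom : ℝ) / 4 ^ J =
        1 - ∑ i ∈ Finset.range J, 2 * (catalan i : ℝ) * (1 / 4 ^ (i + 1)) := by
      have := sum_catalan J
      simp only [mul_one_div]
      linarith
    rw [h1]
    exact (tendsto_finsetSum _ fun i _ => (hratio i).const_mul _).const_sub _
  have hlhs : Tendsto (fun x => |mean s g (N x - j) - ∑ i ∈ Finset.range J,
      (catalan (N x - (j + 1) - i) : ℝ) / catalan (N x - (j + 1) + 1) *
        mean s (sibSum s h g i) (N x - (j + 1 + i))|) U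
      (𝓝 |∑ q, g q * p j q - ∑ i ∈ Finset.range J, 1 / 4 ^ (i + 1) *
        ∑ q, sibSum s h g i q * p (j + 1 + i) q|) :=
    ((hmean g j).sub (tendsto_finsetSum _ fun i _ => (hratio i).mul (hmean _ _))).abs
  refine le_of_tendsto_of_tendsto hlhs hrhs ?_
  filter_upwards [hN.eventually_ge_atTop (j + 1), hsub.eventually_ge_atTop (2 * J)] with x hx hx'
  have h1 := abs_mean_succ_sub_le hs hg (n := N x - (j + 1)) (J := J) (by omega)
  rw [show N x - (j + 1) + 1 = N x - j by omega] at h1 ⊢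
  simpa only [Nat.sub_sub] using h1

theorem tendsto_sum_abs_freq_sub (hs : ∀ l r, s (.node () l r) = h (s l) (s r))
    (hsurj : Function.Surjective s) {N₀ : ℕ}
    (hper : ∀ N, N₀ ≤ N → ∀ q, (fun q => h q (s .nil))^[N + 1] q = (fun q => h q (s .nil))^[N] q) :
    Tendsto (fun x : ℕ × ℕ => ∑ q, |freq s x.1 q - freq s x.2 q|) atTop (𝓝 0) := by
  set F : ℕ × ℕ → ℝ := fun x => ∑ q, |freq s x.1 q - freq s x.2 q| with hF
  have hF0 : ∀ x, 0 ≤ F x := fun x => Finset.sum_nonneg fun q _ => abs_nonneg _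
  have hF2 : ∀ x, F x ≤ 2 := by
    intro x
    have h1 : F x ≤ ∑ q, (freq s x.1 q + freq s x.2 q) := by
      refine Finset.sum_le_sum fun q _ => (abs_sub _ _).trans_eq ?_
      rw [abs_of_nonneg (freq_nonneg _ _), abs_of_nonneg (freq_nonneg _ _)]
    rw [Finset.sum_add_distrib, sum_freq, sum_freq] at h1
    linarith
  have hbdd : IsBoundedUnder (· ≤ ·) atTop F := isBoundedUnder_of ⟨2, hF2⟩
  have hbdd' : IsBoundedUnder (· ≥ ·) atTop F := isBoundedUnder_of ⟨0, hF0⟩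
  set D := limsup F atTop with hDdef
  suffices hD : ¬ 0 < D by
    refine tendsto_of_le_liminf_of_limsup_le ?_ (not_lt.1 hD) hbdd hbdd'
    exact le_liminf_of_le hbdd.isCoboundedUnder_ge (Eventually.of_forall hF0)
  have hcluster : MapClusterPt D atTop F := by
    rw [mapClusterPt_iff_frequently]
    intro V hV
    obtain ⟨ε, hε, hball⟩ := Metric.mem_nhds_iff.1 hV
    have h1 : ∃ᶠ x in atTop, D - ε < F x :=
      frequently_lt_of_lt_limsup hbdd'.isCoboundedUnder_le (by linarith)
    have h2 : ∀ᶠ x in atTop, F x < D + ε := eventually_lt_of_limsup_lt (by linarith) hbdd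
    refine (h1.and_eventually h2).mono fun x hx => hball ?_
    rw [Metric.mem_ball, Real.dist_eq, abs_lt]
    constructor <;> linarith [hx.1, hx.2]
  obtain ⟨U, hU, hUD⟩ := mapClusterPt_iff_ultrafilter.1 hcluster
  have hfst : Tendsto Prod.fst (U : Filter (ℕ × ℕ)) atTop := by
    refine Tendsto.mono_left ?_ hU
    rw [← prod_atTop_atTop_eq]
    exact tendsto_fst
  have hsnd : Tendsto Prod.snd (U : Filter (ℕ × ℕ)) atTop := by
    refine Tendsto.mono_left ?_ hU
    rw [← prod_atTop_atTop_eq]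
    exact tendsto_snd
  obtain ⟨p, hp, hpb⟩ := exists_limit_freq hs U hfst
  obtain ⟨p', hp', hpb'⟩ := exists_limit_freq hs U hsnd
  have hlim : ∀ j, Tendsto (fun x : ℕ × ℕ => F (x.1 - j, x.2 - j)) U
      (𝓝 (∑ q, |p j q - p' j q|)) := fun j =>
    tendsto_finsetSum _ fun q _ => ((hp j q).sub (hp' j q)).abs
  have hone : ∀ j, ∑ q, p j q = 1 := fun j =>
    tendsto_nhds_unique (tendsto_finsetSum _ fun q _ => hp j q)
      (by simp only [sum_freq]; exact tendsto_const_nhds)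
  have hone' : ∀ j, ∑ q, p' j q = 1 := fun j =>
    tendsto_nhds_unique (tendsto_finsetSum _ fun q _ => hp' j q)
      (by simp only [sum_freq]; exact tendsto_const_nhds)
  refine (AncestralBound.sub hpb hpb').not_pos hsurj hper (fun j => ?_) ?_ fun j => ?_
  · refine le_of_forall_pos_le_add fun ε hε => le_of_tendsto (hlim j) ?_
    have h1 : ∀ᶠ x in atTop, F x < D + ε := eventually_lt_of_limsup_lt (by linarith) hbdd
    have h2 : Tendsto (fun x : ℕ × ℕ => (x.1 - j, x.2 - j)) U atTop := by
      rw [← prod_atTop_atTop_eq]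
      exact ((tendsto_sub_atTop_nat j).comp hfst).prodMk ((tendsto_sub_atTop_nat j).comp hsnd)
    exact (h2.eventually h1).mono fun x hx => hx.le
  · exact tendsto_nhds_unique (hlim 0) (by simpa using hUD)
  · rw [Finset.sum_sub_distrib, hone, hone', sub_self]

theorem exists_tendsto_freq (hs : ∀ l r, s (.node () l r) = h (s l) (s r))
    (hsurj : Function.Surjective s) {N₀ : ℕ}
    (hper : ∀ N, N₀ ≤ N → ∀ q, (fun q => h q (s .nil))^[N + 1] q = (fun q => h q (s .nil))^[N] q) :
    ∃ ℓ : Q → ℝ, ∀ q, Tendsto (fun n => freq s n q) atTop (𝓝 (ℓ q)) := by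
  have hcau : ∀ q, CauchySeq fun n => freq s n q := by
    intro q
    rw [cauchySeq_iff_tendsto_dist_atTop_0]
    refine squeeze_zero (fun _ => dist_nonneg) (fun x => ?_) (tendsto_sum_abs_freq_sub hs hsurj hper)
    rw [Real.dist_eq]
    exact Finset.single_le_sum (f := fun q => |freq s x.1 q - freq s x.2 q|)
      (fun _ _ => abs_nonneg _) (Finset.mem_univ q)
  choose ℓ hℓ using fun q => cauchySeq_tendsto_of_complete (hcau q)
  exact ⟨ℓ, hℓ⟩

theorem exists_limit_freq_pos {ℓ : Q → ℝ}
    (hℓ : ∀ q, Tendsto (fun n => freq s n q) atTop (𝓝 (ℓ q))) : ∃ q, 0 < ℓ q := by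
  by_contra! hn
  have h1 : ∑ q, ℓ q = 1 := tendsto_nhds_unique (tendsto_finsetSum _ fun q _ => hℓ q)
    (by simp only [sum_freq]; exact tendsto_const_nhds)
  have h2 := Finset.sum_nonpos fun q (_ : q ∈ Finset.univ) => hn q
  linarith

end Labelling

/-! ### The labelling of binary trees by logical types -/

theorem realized_Hfun {k : ℕ} {t u : QT k} (ht : Realized k t) (hu : Realized k u) :
    Realized k (Hfun k t u) := by
  obtain ⟨p, hp, rfl⟩ := ht
  obtain ⟨q, hq, rfl⟩ := hu
  exact ⟨glue p q, avoidsF_glue.2 ⟨hp, hq⟩, typeOf_glue k p q⟩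

/-- The operation `H_k` on the realized types. -/
noncomputable def hTk (k : ℕ) (t u : Tk k) : Tk k := ⟨Hfun k t.1 u.1, realized_Hfun t.2 u.2⟩

/-- The logical type of the permutation encoded by a binary tree. -/
def treeType (k : ℕ) (x : BinaryTree Unit) : Tk k :=
  ⟨typeOf k (toPerm x), toPerm x, avoidsF_toPerm x, rfl⟩

theorem treeType_node (k : ℕ) (l r : BinaryTree Unit) :
    treeType k (.node () l r) = hTk k (treeType k l) (treeType k r) :=
  Subtype.ext (typeOf_glue k (toPerm l) (toPerm r))

theorem treeType_surjective (k : ℕ) : Function.Surjective (treeType k) := by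
  rintro ⟨_, p, hp, rfl⟩
  obtain ⟨x, hx⟩ := exists_toPerm_eq hp
  exact ⟨x, Subtype.ext (congrArg (typeOf k) hx)⟩

theorem iterate_hTk_nil (k N : ℕ) (x : BinaryTree Unit) :
    ((fun q => hTk k q (treeType k .nil))^[N] (treeType k x)).1 = typeOf k (pad N (toPerm x)) := by
  induction N with
  | zero => rfl
  | succ N ih =>
    rw [Function.iterate_succ_apply', pad_succ, typeOf_glue, ← ih]
    rfl

theorem iterate_hTk_nil_stable (k N : ℕ) (hN : 2 * 2 ^ k ≤ N) (q : Tk k) :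
    (fun q => hTk k q (treeType k .nil))^[N + 1] q =
      (fun q => hTk k q (treeType k .nil))^[N] q := by
  obtain ⟨x, rfl⟩ := treeType_surjective k q
  refine Subtype.ext ?_
  rw [iterate_hTk_nil, iterate_hTk_nil]
  exact (Quotient.sound (kEquiv_pad k N hN (toPerm x))).symm

open Classical in
theorem cnt_eq_freq_mul (k : ℕ) (t : Tk k) (n : ℕ) :
    (cnt k t.1 n : ℝ) = freq (treeType k) n t * catalan n := by
  rw [freq, div_mul_cancel₀ _ (catalan_pos n).ne', cnt_eq_card]
  congr 2
  refine Finset.filter_congr fun x _ => ?_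
  exact (Subtype.ext_iff (a1 := treeType k x) (a2 := t)).symm

/-- For every type `t` in the terminal strongly connected component `𝒯ₖ★`, there is a
constant `A_t > 0` with `[zⁿ] C_t ∼ A_t · 4ⁿ · n^{-3/2}`. -/
theorem critical_types_asymptotics (k : ℕ) (hk : 2 ≤ k) (S : Set (Tk k))
    (hS : IsTermSCC k S) (t : Tk k) (ht : t ∈ S) :
    ∃ A : ℝ, 0 < A ∧
      (fun n : ℕ => (cnt k t.1 n : ℝ)) ~[atTop]
        fun n : ℕ => A * 4 ^ n * (n : ℝ) ^ (-(3 : ℝ) / 2) := by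
  classical
  have := finite_QT k
  have : Finite (Tk k) := Subtype.finite
  have : Fintype (Tk k) := Fintype.ofFinite _
  obtain ⟨ℓ, hℓ⟩ := exists_tendsto_freq (treeType_node k) (treeType_surjective k)
    (iterate_hTk_nil_stable k)
  have hedge : ∀ u v : Tk k, EdgeT k u v → 0 < ℓ u → 0 < ℓ v := by
    rintro u v ⟨w, hw, huv | huv⟩ hu
    · rw [show v = hTk k u ⟨w, hw⟩ from Subtype.ext huv.symm]
      exact limit_freq_pos_left (treeType_node k) (treeType_surjective k) hℓ hu _
    · rw [show v = hTk k ⟨w, hw⟩ u from Subtype.ext huv.symm]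
      exact limit_freq_pos_right (treeType_node k) (treeType_surjective k) hℓ hu _
  obtain ⟨u, hu⟩ := exists_limit_freq_pos hℓ
  have hut : 0 < ℓ (hTk k u t) :=
    limit_freq_pos_left (treeType_node k) (treeType_surjective k) hℓ hu t
  have hmem : hTk k u t ∈ S := hS.2.2 t ht _ ⟨u.1, u.2, Or.inr rfl⟩
  have hreach : ∀ v, Relation.ReflTransGen (EdgeT k) (hTk k u t) v → 0 < ℓ v := by
    intro v hv
    induction hv with
    | refl => exact hut
    | tail _ hvw ih => exact hedge _ _ hvw ih
  have hpos : 0 < ℓ t := hreach t (hS.2.1 _ hmem t ht)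
  have hA : 0 < ℓ t * (1 / √Real.pi) := mul_pos hpos (by positivity)
  refine ⟨ℓ t * (1 / √Real.pi), hA, isEquivalent_of_tendsto_one ?_⟩
  have hlim := ((hℓ t).mul tendsto_catalan_div).div_const (ℓ t * (1 / √Real.pi))
  rw [div_self hA.ne'] at hlim
  refine hlim.congr fun n => ?_
  rw [Pi.div_apply, cnt_eq_freq_mul, mul_div_assoc', div_div]
  congr 1
  ring

end Av231
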